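/- Let d ≥ 2. There exists 0 < L < ∞ with the following property: whenever β, δ > 0 satisfy β - δ > L, then for every translation invariant, spin-flip symmetric interaction Ψ on Ω = {1,-1}^{Z^d} with ‖Ψ‖ < δ which is zero on non-‖·‖_1-connected sets, the interaction Φ = Φ^β + Ψ has at least two distinct translation-invariant Gibbs states (equivalently, more than one equilibrium state). -/

import Mathlib

open scoped BigOperators
open Real MeasureTheory Filter Topology

namespace Ising

/-- The lattice `ℤ^d`. -/
abbrev V (d : ℕ) := Fin d → ℤ
/-- Spin configurations on `ℤ^d`; `true` encodes spin `+1`, `false` encodes spin `-1`. -/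
abbrev Config (d : ℕ) := V d → Bool
/-- The ambient euclidean space `ℝ^d`. -/
abbrev Point (d : ℕ) := Fin d → ℝ

variable {d : ℕ}

noncomputable section

/-- The spin value (`±1`) of a boolean. -/
def spin (b : Bool) : ℝ := if b then 1 else -1

/-- An interaction assigns to each finite `Λ ⊆ ℤ^d` a function of configurations
(only the restriction to `Λ` is relevant; see `IsLocal`). -/
abbrev Interaction (d : ℕ) := Finset (V d) → Config d → ℝ

/-- `Φ_Λ` depends only on the restriction of the configuration to `Λ`. -/
def IsLocal (Φ : Interaction d) : Prop :=
  ∀ (Λ : Finset (V d)) (ω ω' : Config d), (∀ x ∈ Λ, ω x = ω' x) → Φ Λ ω = Φ Λ ω'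

/-- Translation of a configuration: `(τ^a ω)(x) = ω(x+a)`. -/
def translate (a : V d) (ω : Config d) : Config d := fun x => ω (x + a)

/-- Translation invariance of an interaction: `Φ_Λ(ω) = Φ_{Λ-a}(τ^a ω)`. -/
def TransInv (Φ : Interaction d) : Prop :=
  ∀ (a : V d) (Λ : Finset (V d)) (ω : Config d),
    Φ (Λ.image (fun x => x - a)) (translate a ω) = Φ Λ ω

/-- Spin-flip symmetry: `Ψ_Λ(ω) = Ψ_Λ(-ω)`. -/
def SpinFlipSymm (Ψ : Interaction d) : Prop :=
  ∀ (Λ : Finset (V d)) (ω : Config d), Ψ Λ (fun x => !(ω x)) = Ψ Λ ω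

/-- `sup_{ω ∈ Ω_Λ} |Φ_Λ(ω)|`. -/
def supNorm (Φ : Interaction d) (Λ : Finset (V d)) : ℝ := ⨆ ω : Config d, |Φ Λ ω|

/-- The summand of the norm `‖Φ‖`. -/
def normTerm (Φ : Interaction d) (Λ : Finset (V d)) : ℝ :=
  if (0 : V d) ∈ Λ then supNorm Φ Λ else 0

/-- `‖Φ‖ = Σ_{0 ∈ Λ ⋐ ℤ^d} sup_{ω} |Φ_Λ(ω)|`. -/
def anorm (Φ : Interaction d) : ℝ := ∑' Λ : Finset (V d), normTerm Φ Λ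

/-- Absolute summability of an interaction. -/
def AbsSummable (Φ : Interaction d) : Prop := Summable (normTerm Φ)

/-- `‖x-y‖_∞`. -/
def distInf (x y : V d) : ℕ := Finset.univ.sup fun i => (x i - y i).natAbs

/-- `‖x-y‖_1`. -/
def dist1 (x y : V d) : ℕ := ∑ i, (x i - y i).natAbs

/-- `diam(Λ) = sup {‖x-y‖_∞ : x, y ∈ Λ}`. -/
def diam (Λ : Finset (V d)) : ℕ := Λ.sup fun x => Λ.sup fun y => distInf x y

/-- The summand of the `d`-th order decaying norm `|||Ψ|||`. -/
def dTerm (Ψ : Interaction d) (Λ : Finset (V d)) : ℝ :=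
  if (0 : V d) ∈ Λ then ((diam Λ + 1 : ℕ) : ℝ) ^ d * supNorm Ψ Λ else 0

/-- `|||Ψ||| = Σ_{0 ∈ Λ ⋐ ℤ^d} (diam(Λ)+1)^d sup_{ω} |Ψ_Λ(ω)|`. -/
def dnorm (Ψ : Interaction d) : ℝ := ∑' Λ : Finset (V d), dTerm Ψ Λ

/-- Summability of the `d`-th order decaying norm. -/
def DSummable (Ψ : Interaction d) : Prop := Summable (dTerm Ψ)

/-- The summand of the norm `|||Ψ|||'`. -/
def dTerm' (Ψ : Interaction d) (Λ : Finset (V d)) : ℝ :=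
  if (0 : V d) ∈ Λ then (Λ.card : ℝ)⁻¹ * ((diam Λ + 1 : ℕ) : ℝ) ^ d * supNorm Ψ Λ else 0

/-- `|||Ψ|||' = Σ_{0 ∈ Λ ⋐ ℤ^d} |Λ|⁻¹ (diam(Λ)+1)^d sup_{ω} |Ψ_Λ(ω)|`. -/
def dnorm' (Ψ : Interaction d) : ℝ := ∑' Λ : Finset (V d), dTerm' Ψ Λ

/-- Summability of the norm `|||·|||'`. -/
def DSummable' (Ψ : Interaction d) : Prop := Summable (dTerm' Ψ)

/-- The Hamiltonian `H_{Φ,Λ}(ω) = Σ_{Δ ⋐ ℤ^d, Δ ∩ Λ ≠ ∅} Φ_Δ(ω|_Δ)`. -/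
def ham (Φ : Interaction d) (Λ : Finset (V d)) (ω : Config d) : ℝ :=
  ∑' Δ : Finset (V d), if (Δ ∩ Λ).Nonempty then Φ Δ ω else 0

/-- The configuration `ω_Λ ∨ η` agreeing with `f` on `Λ` and with `η` off `Λ`. -/
def fill (Λ : Finset (V d)) (f : ↥Λ → Bool) (η : Config d) : Config d :=
  fun x => if h : x ∈ Λ then f ⟨x, h⟩ else η x

/-- The partition function `Z^η_{Φ,Λ}`. -/
def gibbsZ (Φ : Interaction d) (Λ : Finset (V d)) (η : Config d) : ℝ :=
  ∑ f : ↥Λ → Bool, Real.exp (-(ham Φ Λ (fill Λ f η)))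

/-- The finite Gibbs state `μ^η_{Φ,Λ}({ω_Λ})`. -/
def finGibbs (Φ : Interaction d) (Λ : Finset (V d)) (η : Config d) (f : ↥Λ → Bool) : ℝ :=
  Real.exp (-(ham Φ Λ (fill Λ f η))) / gibbsZ Φ Λ η

/-- The cylinder set `{ξ : ξ|_Λ = f}`. -/
def cyl (Λ : Finset (V d)) (f : ↥Λ → Bool) : Set (Config d) :=
  {ξ | ∀ (x : V d) (h : x ∈ Λ), ξ x = f ⟨x, h⟩}

/-- `σ` is a Gibbs state for `Φ` (DLR condition): for each finite `Λ` there is a Borel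
probability measure on boundary conditions with respect to which `σ` of each cylinder
is the average of the finite Gibbs states. -/
def IsGibbs (Φ : Interaction d) (σ : Measure (Config d)) : Prop :=
  IsProbabilityMeasure σ ∧
  ∀ Λ : Finset (V d), ∃ ν : Measure (Config d), IsProbabilityMeasure ν ∧
    ∀ f : ↥Λ → Bool, (σ (cyl Λ f)).toReal = ∫ η, finGibbs Φ Λ η f ∂ν

/-- Translation invariance of a measure: `τ^a_* σ = σ`. -/
def MeasTransInv (σ : Measure (Config d)) : Prop :=
  ∀ a : V d, σ.map (translate a) = σ

/-- The Ising interaction at inverse temperature `β`: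
`Φ^β_Λ(ω) = -β ω(x) ω(y)` if `Λ = {x,y}` with `‖x-y‖₁ = 1`, and `0` otherwise. -/
def ising (β : ℝ) : Interaction d := fun Λ ω =>
  if Λ.card = 2 ∧ ∀ x ∈ Λ, ∀ y ∈ Λ, x ≠ y → dist1 x y = 1
  then -β * ∏ x ∈ Λ, spin (ω x) else 0

/-- The sum of two interactions. -/
def Iadd (Φ Ψ : Interaction d) : Interaction d := fun Λ ω => Φ Λ ω + Ψ Λ ω

/-- `S` is connected for the adjacency given by `ρ`-distance `1`. -/
def ConnectedBy (ρ : V d → V d → ℕ) (S : Set (V d)) : Prop :=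
  ∀ x ∈ S, ∀ y ∈ S, ∃ (n : ℕ) (p : ℕ → V d), p 0 = x ∧ p n = y ∧
    (∀ i ≤ n, p i ∈ S) ∧ ∀ i < n, ρ (p i) (p (i+1)) = 1

/-- `‖·‖₁`-connectedness. -/
def Conn1 (S : Set (V d)) : Prop := ConnectedBy dist1 S

/-- `‖·‖_∞`-connectedness. -/
def ConnInf (S : Set (V d)) : Prop := ConnectedBy distInf S

/-- A finite set `Λ` is c-connected if both `Λ` and its complement are `‖·‖_∞`-connected. -/
def CConn (Λ : Finset (V d)) : Prop :=
  ConnInf (↑Λ : Set (V d)) ∧ ConnInf ((↑Λ : Set (V d))ᶜ)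

/-- `Ψ` vanishes on sets that are not `‖·‖₁`-connected. -/
def ZeroOnNonConn (Ψ : Interaction d) : Prop :=
  ∀ Λ : Finset (V d), ¬ Conn1 (↑Λ : Set (V d)) → ∀ ω, Ψ Λ ω = 0

/-- The closed unit cube `I_x` centered at `x ∈ ℤ^d`. -/
def cube (x : V d) : Set (Point d) := {y | ∀ i, |y i - (x i : ℝ)| ≤ 1/2}

/-- `M(S) = ⋃_{x ∈ S} I_x`. -/
def cubes (S : Set (V d)) : Set (Point d) := ⋃ x ∈ S, cube x

/-- A contour is the boundary `∂M(S)` of `M(S)` for a finite c-connected `S`. -/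
def IsContour (γ : Set (Point d)) : Prop :=
  ∃ S : Finset (V d), CConn S ∧ γ = frontier (cubes ↑S)

/-- The set of sites with spin `-1`. -/
def minusSet (ω : Config d) : Set (V d) := {x | ω x = false}

/-- `Γ(ω)`: the connected components of `∂M({x : ω(x) = -1})`. -/
def Gamma (ω : Config d) : Set (Set (Point d)) :=
  {γ | ∃ y ∈ frontier (cubes (minusSet ω)),
    γ = connectedComponentIn (frontier (cubes (minusSet ω))) y}

/-- The `(d-1)`-dimensional face of the unit cubes lying between `x` and `x + e_i`. -/
def face (x : V d) (i : Fin d) : Set (Point d) :=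
  {y | y i = (x i : ℝ) + 1/2 ∧ ∀ j, j ≠ i → |y j - (x j : ℝ)| ≤ 1/2}

/-- A plaquette is a `(d-1)`-dimensional face of one of the cubes `I_x`. -/
def IsPlaquette (P : Set (Point d)) : Prop := ∃ x i, P = face x i

/-- `|γ|`: the number of plaquettes contained in `γ`. -/
def csize (γ : Set (Point d)) : ℕ :=
  Nat.card {P : Set (Point d) // IsPlaquette P ∧ P ⊆ γ}

/-- The constant `+1` configuration. -/
def plusC : Config d := fun _ => true

/-- The constant `-1` configuration. -/
def minusC : Config d := fun _ => false

open scoped Classical in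
/-- The finite-volume Gibbs probability (with boundary condition `η`) of an event
`A`: `μ^η_{Φ,Λ}({ω : ω ∨ η ∈ A})`. -/
def bcProb (Φ : Interaction d) (Λ : Finset (V d)) (η : Config d) (A : Set (Config d)) : ℝ :=
  (∑ f : ↥Λ → Bool, if fill Λ f η ∈ A then Real.exp (-(ham Φ Λ (fill Λ f η))) else 0) /
    gibbsZ Φ Λ η

/-- `ω ∈ Ω_Λ^+`, i.e. `ω` is `+1` off `Λ`. -/
def plusOutside (Λ : Finset (V d)) (ω : Config d) : Prop := ∀ x, x ∉ Λ → ω x = true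

/-- The configuration obtained by flipping all spins in `S`. -/
def flipOn (S : Finset (V d)) (ω : Config d) : Config d :=
  fun x => if x ∈ S then !(ω x) else ω x

/-- `|𝓔_Λ|`: the number of nearest-neighbour edges meeting `Λ`. -/
def edgeCount (Λ : Finset (V d)) : ℕ :=
  Nat.card {e : Finset (V d) // (∃ x y, e = {x, y} ∧ dist1 x y = 1) ∧ (e ∩ Λ).Nonempty}

/-- `R` is a (nonempty) rectangle in `ℤ^d`. -/
def IsRect (R : Finset (V d)) : Prop := ∃ a b : V d, a ≤ b ∧ R = Finset.Icc a b

/-- `R(Λ)`: the minimal rectangle containing `Λ`. -/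
def minRect (Λ : Finset (V d)) : Finset (V d) :=
  if h : Λ.Nonempty then
    Finset.Icc (fun i => Λ.inf' h fun x => x i) (fun i => Λ.sup' h fun x => x i)
  else ∅

open scoped Classical in
/-- The rectangle regrouping `Ψ̃` of `Ψ`: `Ψ̃_R(ω) = Σ_{Λ : R(Λ) = R} Ψ_Λ(ω|_Λ)` for
rectangles `R`, and `Ψ̃_Λ = 0` for non-rectangles. -/
def regroup (Ψ : Interaction d) : Interaction d := fun R ω =>
  if IsRect R then ∑ Λ ∈ R.powerset, (if minRect Λ = R then Ψ Λ ω else 0) else 0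


/-- unit vector -/
def ee (i : Fin d) : V d := Pi.single i 1

/-- oriented nearest-neighbour edges -/
abbrev Edge (d : ℕ) := V d × Fin d

/-- the second endpoint of an edge -/
def tip (e : Edge d) : V d := e.1 + ee e.2

/-- closeness of edges -/
def adjE (a b : Edge d) : Prop := ∀ i, |a.1 i - b.1 i| ≤ 1

lemma adjE_symm {a b : Edge d} (h : adjE a b) : adjE b a := fun i => by
  rw [abs_sub_comm]; exact h i

lemma exists_prim (f : ℤ → ZMod 2) : ∃ F : ℤ → ZMod 2, ∀ t, F (t + 1) = F t + f t := by
  refine ⟨fun t => ∑ s ∈ Finset.Ico 0 t, f s - ∑ s ∈ Finset.Ico t 0, f s, fun t => ?_⟩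
  dsimp only
  rcases le_or_gt 0 t with h | h
  · rw [Finset.Ico_eq_empty_of_le h, Finset.Ico_eq_empty_of_le (by omega : (0:ℤ) ≤ t + 1)]
    have : Finset.Ico 0 (t + 1) = insert t (Finset.Ico 0 t) := by
      ext s; simp only [Finset.mem_Ico, Finset.mem_insert]; omega
    rw [this, Finset.sum_insert (by simp)]
    simp [add_comm]
  · rw [Finset.Ico_eq_empty_of_le h.le, Finset.Ico_eq_empty_of_le (by omega : t + 1 ≤ (0:ℤ))]
    have : Finset.Ico t 0 = insert t (Finset.Ico (t + 1) 0) := by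
      ext s; simp only [Finset.mem_Ico, Finset.mem_insert]; omega
    rw [this, Finset.sum_insert (by simp)]
    simp only [Finset.sum_empty]
    ring

lemma poincare_aux (φ : V d → Fin d → ZMod 2)
    (hc : ∀ x i j, φ x i + φ (x + ee i) j = φ x j + φ (x + ee j) i) (s : Finset (Fin d)) :
    ∃ χ : V d → ZMod 2, ∀ i ∈ s, ∀ x, χ (x + ee i) = χ x + φ x i := by
  classical
  induction s using Finset.induction_on with
  | empty => exact ⟨0, by simp⟩
  | insert k s hk ih =>
    obtain ⟨χ, hχ⟩ := ih
    choose prim hprim using exists_prim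
    set ψ : V d → Fin d → ZMod 2 := fun x i => φ x i - (χ (x + ee i) - χ x) with hψ
    have hψc : ∀ x i j, ψ x i + ψ (x + ee i) j = ψ x j + ψ (x + ee j) i := by
      intro x i j
      simp only [hψ]
      rw [add_right_comm x (ee j) (ee i)]
      linear_combination hc x i j
    have hψ0 : ∀ i ∈ s, ∀ x, ψ x i = 0 := by
      intro i hi x; simp only [hψ]; rw [hχ i hi x]; ring
    have hinv : ∀ i ∈ s, ∀ x, ψ (x + ee i) k = ψ x k := by
      intro i hi x
      have := hψc x i k
      rw [hψ0 i hi, hψ0 i hi] at this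
      simpa using this
    refine ⟨fun x => χ x + prim (fun t => ψ (Function.update x k t) k) (x k), ?_⟩
    intro i hi x
    rcases Finset.mem_insert.1 hi with rfl | his
    · have h1 : (fun t => ψ (Function.update (x + ee i) i t) i)
          = (fun t => ψ (Function.update x i t) i) := by
        funext t; congr 1
        funext j
        by_cases hj : j = i
        · subst hj; simp
        · simp [Function.update_of_ne hj, ee, hj]
      have h2 : (x + ee i) i = x i + 1 := by simp [ee]
      simp only [h1, h2]
      rw [hprim]
      simp only [Function.update_eq_self, hψ]
      ring
    · have hik : i ≠ k := fun h => hk (h ▸ his)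
      have h1 : (fun t => ψ (Function.update (x + ee i) k t) k)
          = (fun t => ψ (Function.update x k t) k) := by
        funext t
        rw [← hinv i his (Function.update x k t)]
        congr 1
        funext j
        by_cases hj : j = k
        · subst hj; simp [ee, hik.symm]
        · simp [Function.update_of_ne hj]
      have h2 : (x + ee i) k = x k := by simp [ee, hik.symm]
      simp only [h1, h2, hχ i his x]
      ring

lemma poincare (φ : V d → Fin d → ZMod 2)
    (hc : ∀ x i j, φ x i + φ (x + ee i) j = φ x j + φ (x + ee j) i) :
    ∃ χ : V d → ZMod 2, ∀ x i, χ (x + ee i) = χ x + φ x i := by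
  obtain ⟨χ, h⟩ := poincare_aux φ hc Finset.univ
  exact ⟨χ, fun x i => h i (Finset.mem_univ _) x⟩

/-- cubical box -/
def box (d n : ℕ) : Finset (V d) := Finset.Icc (fun _ => -(n:ℤ)) (fun _ => (n:ℤ))

lemma mem_box {n : ℕ} {x : V d} : x ∈ box d n ↔ ∀ i, |x i| ≤ n := by
  simp only [box, Finset.mem_Icc, Pi.le_def, abs_le, forall_and]

lemma not_mem_box {n : ℕ} {x : V d} : x ∉ box d n ↔ ∃ i, (n:ℤ) < |x i| := by
  simp [mem_box]

lemma line_const {α : Type*} (g : ℤ → α) (h : ∀ t, g (t + 1) = g t) (s : ℤ) : g s = g 0 := by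
  induction s using Int.induction_on with
  | zero => rfl
  | succ i ih => rw [h, ih]
  | pred i ih => rw [← ih, ← h (-(i:ℤ) - 1)]; simp

lemma update_add_ee (y : V d) (i : Fin d) (t : ℤ) :
    Function.update y i (t + 1) = Function.update y i t + ee i := by
  funext j
  by_cases hj : j = i
  · subst hj; simp [ee]
  · simp [Function.update_of_ne hj, ee, hj]

lemma box_const_move {α : Type*} (χ : V d → α) (n : ℕ)
    (h : ∀ y i, y ∉ box d n → y + ee i ∉ box d n → χ (y + ee i) = χ y)
    (y : V d) (i j : Fin d) (hij : i ≠ j) (hi : (n:ℤ) < |y i|) (t : ℤ) :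
    χ (Function.update y j t) = χ y := by
  have hout : ∀ s, Function.update y j s ∉ box d n := fun s =>
    not_mem_box.2 ⟨i, by rwa [Function.update_of_ne hij]⟩
  have key : ∀ s, χ (Function.update y j s) = χ (Function.update y j 0) := by
    apply line_const (fun s => χ (Function.update y j s))
    intro s
    have h3 := hout (s + 1)
    simp only [update_add_ee] at h3 ⊢
    exact h _ _ (hout s) h3
  rw [key t, ← key (y j), Function.update_eq_self]

lemma box_const (hd : 2 ≤ d) {α : Type*} (χ : V d → α) (n : ℕ)
    (h : ∀ y i, y ∉ box d n → y + ee i ∉ box d n → χ (y + ee i) = χ y) (y : V d)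
    (hy : y ∉ box d n) : χ y = χ (fun _ => (n:ℤ) + 1) := by
  classical
  obtain ⟨i, hi⟩ := not_mem_box.1 hy
  have step : ∀ s : Finset (Fin d), i ∉ s →
      χ (fun j => if j ∈ s then (n:ℤ) + 1 else y j) = χ y := by
    intro s
    induction s using Finset.induction_on with
    | empty => intro _; simp
    | insert k s hk ih =>
      intro his
      rw [Finset.mem_insert, not_or] at his
      rw [← ih his.2]
      rw [← box_const_move χ n h (fun j => if j ∈ s then (n:ℤ) + 1 else y j) i k his.1
        (by simpa [his.2] using hi) (n + 1)]
      congr 1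
      funext j
      by_cases hj : j = k
      · subst hj; simp
      · simp [Function.update_of_ne hj, hj]
  have hs := step (Finset.univ.erase i) (by simp)
  rw [← hs]
  have : Nontrivial (Fin d) := Fin.nontrivial_iff_two_le.2 hd
  obtain ⟨j, hj⟩ := exists_ne i
  rw [← box_const_move χ n h _ j i hj (by
    simp only [Finset.mem_erase, Finset.mem_univ, hj, and_true, ne_eq, not_false_eq_true, if_true]
    rw [abs_of_nonneg (by positivity)]; omega) (n + 1)]
  congr 1
  funext l
  by_cases hl : l = i
  · subst hl; simp
  · simp [Function.update_of_ne hl, hl]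

/-- edge boundary of a finite set of sites -/
def bd (S : Finset (V d)) : Finset (Edge d) :=
  ((S ×ˢ Finset.univ) ∪ (S ×ˢ Finset.univ).image (fun p : V d × Fin d => (p.1 - ee p.2, p.2))).filter
    (fun e => ¬ (e.1 ∈ S ↔ tip e ∈ S))

lemma mem_bd {S : Finset (V d)} {e : Edge d} : e ∈ bd S ↔ ¬ (e.1 ∈ S ↔ tip e ∈ S) := by
  constructor
  · intro h; exact (Finset.mem_filter.1 h).2
  · intro h
    refine Finset.mem_filter.2 ⟨?_, h⟩
    by_cases h1 : e.1 ∈ S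
    · exact Finset.mem_union_left _ (by simp [h1])
    · have h2 : tip e ∈ S := by tauto
      refine Finset.mem_union_right _ (Finset.mem_image.2 ⟨(tip e, e.2), by simp [h2], ?_⟩)
      simp [tip]

/-- connectedness of a finite set of edges -/
def EConn (T : Finset (Edge d)) : Prop :=
  ∀ U ⊆ T, U.Nonempty → (∀ a ∈ U, ∀ b ∈ T, adjE a b → b ∈ U) → U = T

lemma adjE_sq (x u v : V d) (k l : Fin d) (hu : ∀ m, 0 ≤ u m ∧ u m ≤ 1)
    (hv : ∀ m, 0 ≤ v m ∧ v m ≤ 1) : adjE (x + u, k) (x + v, l) := by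
  intro m
  have := hu m
  have := hv m
  simp only [Pi.add_apply]
  rw [abs_le]; constructor <;> linarith

lemma ee_01 (i m : Fin d) : 0 ≤ ee i m ∧ ee i m ≤ 1 := by
  by_cases h : m = i
  · subst h; simp [ee]
  · simp [ee, h]

lemma exists_fill (hd : 2 ≤ d) (N : ℕ) (S : Finset (V d)) (hS : S ⊆ box d N)
    (U : Finset (Edge d)) (hU : U ⊆ bd S) (hcl : ∀ a ∈ U, ∀ b ∈ bd S, adjE a b → b ∈ U) :
    ∃ S₁ ⊆ box d N, bd S₁ = U := by
  classical
  set φ : V d → Fin d → ZMod 2 := fun x i => if (x, i) ∈ U then 1 else 0 with hφ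
  set ψ : V d → Fin d → ZMod 2 := fun x i => if (x, i) ∈ bd S then 1 else 0 with hψ
  have hψ' : ∀ x i, ψ x i = (if x + ee i ∈ S then 1 else 0) - (if x ∈ S then 1 else 0) := by
    intro x i
    simp only [hψ, mem_bd, tip]
    by_cases h1 : x ∈ S <;> by_cases h2 : x + ee i ∈ S <;> simp [h1, h2]
  have hψc : ∀ x i j, ψ x i + ψ (x + ee i) j = ψ x j + ψ (x + ee j) i := by
    intro x i j
    simp only [hψ']
    rw [add_right_comm x (ee j) (ee i)]
    ring
  have hφc : ∀ x i j, φ x i + φ (x + ee i) j = φ x j + φ (x + ee j) i := by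
    intro x i j
    have z01 : ∀ m, (0:ℤ) ≤ (0 : V d) m ∧ (0 : V d) m ≤ 1 := by intro m; simp
    have key : ∀ u k, (∀ m, 0 ≤ u m ∧ u m ≤ 1) → (x + u, k) ∈ U →
        ∀ v l, (∀ m, 0 ≤ v m ∧ v m ≤ 1) → φ (x + v) l = ψ (x + v) l := by
      intro u k hu hk v l hv
      have : (x + v, l) ∈ U ↔ (x + v, l) ∈ bd S :=
        ⟨fun h => hU h, fun h => hcl _ hk _ h (adjE_sq x u v k l hu hv)⟩
      simp only [hφ, hψ, this]
    have key2 : ∀ u k, (∀ m, 0 ≤ u m ∧ u m ≤ 1) → (x + u, k) ∈ U →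
        φ x i + φ (x + ee i) j = φ x j + φ (x + ee j) i := by
      intro u k hu hk
      have h1 := key u k hu hk 0 i z01
      have h2 := key u k hu hk 0 j z01
      rw [add_zero] at h1 h2
      rw [h1, h2, key u k hu hk (ee i) j (ee_01 i), key u k hu hk (ee j) i (ee_01 j), hψc]
    by_cases h1 : (x, i) ∈ U
    · exact key2 0 i z01 (by simpa using h1)
    by_cases h2 : (x, j) ∈ U
    · exact key2 0 j z01 (by simpa using h2)
    by_cases h3 : (x + ee i, j) ∈ U
    · exact key2 _ j (ee_01 i) h3
    by_cases h4 : (x + ee j, i) ∈ U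
    · exact key2 _ i (ee_01 j) h4
    simp [hφ, h1, h2, h3, h4]
  obtain ⟨χ, hχ⟩ := poincare φ hφc
  set c := χ (fun _ => (N:ℤ) + 1)
  have hout : ∀ y, y ∉ box d N → χ y = c := by
    apply box_const hd χ N
    intro y i hy hyi
    rw [hχ]
    have : (y, i) ∉ U := fun h => by
      have := mem_bd.1 (hU h)
      exact this ⟨fun h => absurd (hS h) hy, fun h => absurd (hS h) hyi⟩
    simp [hφ, this]
  refine ⟨(box d N).filter (fun y => χ y ≠ c), Finset.filter_subset _ _, ?_⟩
  have hmem : ∀ y, y ∈ (box d N).filter (fun y => χ y ≠ c) ↔ χ y ≠ c := by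
    intro y
    rw [Finset.mem_filter]
    refine ⟨fun h => h.2, fun h => ⟨?_, h⟩⟩
    by_contra h'
    exact h (hout y h')
  ext ⟨y, i⟩
  rw [mem_bd, hmem, hmem]
  simp only [tip]
  rw [hχ]
  by_cases h : (y, i) ∈ U
  · simp only [hφ, h, if_true, iff_true]
    generalize χ y = p
    generalize c = q
    revert p q; decide
  · simp [hφ, h]

lemma exists_conn (hd : 2 ≤ d) (N : ℕ) (x : V d) : ∀ (n : ℕ) (S : Finset (V d)), (bd S).card = n →
    S ⊆ box d N → x ∈ S → ∃ S' ⊆ box d N, x ∈ S' ∧ bd S' ⊆ bd S ∧ EConn (bd S') := by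
  intro n
  induction n using Nat.strong_induction_on with
  | _ n ih =>
    intro S hn hS hx
    by_cases hc : EConn (bd S)
    · exact ⟨S, hS, hx, subset_rfl, hc⟩
    · simp only [EConn, not_forall] at hc
      obtain ⟨U, hU, hne, hcl, hUne⟩ := hc
      obtain ⟨S₁, hS₁, rfl⟩ := exists_fill hd N S hS U hU hcl
      by_cases hx1 : x ∈ S₁
      · have hlt : (bd S₁).card < n := hn ▸ Finset.card_lt_card (lt_of_le_of_ne hU hUne)
        obtain ⟨S', h1, h2, h3, h4⟩ := ih _ hlt S₁ rfl hS₁ hx1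
        exact ⟨S', h1, h2, h3.trans hU, h4⟩
      · set S₂ := (S \ S₁) ∪ (S₁ \ S) with hS₂
        have hb : bd S₂ = bd S \ bd S₁ := by
          ext e
          have := @hU e
          simp only [mem_bd, Finset.mem_sdiff, hS₂, Finset.mem_union] at this ⊢
          clear * - this
          revert this
          by_cases a1 : e.1 ∈ S <;> by_cases a2 : e.1 ∈ S₁ <;> by_cases a3 : tip e ∈ S <;>
            by_cases a4 : tip e ∈ S₁ <;> simp [a1, a2, a3, a4]
        have hlt : (bd S₂).card < n := by
          rw [hb, ← hn]
          refine Finset.card_lt_card ?_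
          refine Finset.sdiff_ssubset hU hne
        obtain ⟨S', h1, h2, h3, h4⟩ := ih _ hlt S₂ rfl
          (Finset.union_subset (Finset.sdiff_subset.trans hS) (Finset.sdiff_subset.trans hS₁))
          (by simp [hS₂, hx, hx1])
        exact ⟨S', h1, h2, h3.trans (hb ▸ Finset.sdiff_subset), h4⟩

/-- neighbourhood of an edge -/
def nbrs (e : Edge d) : Finset (Edge d) :=
  (Finset.Icc (fun i => e.1 i - 1) (fun i => e.1 i + 1)) ×ˢ Finset.univ

lemma mem_nbrs {a b : Edge d} : b ∈ nbrs a ↔ adjE a b := by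
  simp only [nbrs, Finset.mem_product, Finset.mem_univ, and_true, Finset.mem_Icc, Pi.le_def, adjE,
    abs_le, ← forall_and]
  refine forall_congr' fun i => ?_
  omega

/-- branching constant -/
def DD (d : ℕ) : ℕ := 3 ^ d * d

lemma card_nbrs (a : Edge d) : (nbrs a).card = DD d := by
  simp only [nbrs, Finset.card_product, Pi.card_Icc, Int.card_Icc, DD, Finset.card_univ,
    Fintype.card_fin]
  congr 1
  have : ∀ i, (a.1 i + 1 + 1 - (a.1 i - 1)).toNat = 3 := fun i => by omega
  simp [this]

/-- chains with `m` steps from `e` -/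
def chains : ℕ → Edge d → Finset (List (Edge d))
  | 0, e => {[e]}
  | m + 1, e => (nbrs e).biUnion fun a => (chains m a).image (fun l => e :: l)

lemma card_chains (m : ℕ) (e : Edge d) : (chains m e).card ≤ DD d ^ m := by
  induction m generalizing e with
  | zero => simp [chains]
  | succ m ih =>
    rw [chains]
    refine (Finset.card_biUnion_le).trans ?_
    refine (Finset.sum_le_sum (fun a _ => Finset.card_image_le.trans (ih a))).trans ?_
    rw [Finset.sum_const, card_nbrs, smul_eq_mul, pow_succ, mul_comm]

lemma mem_chains (m : ℕ) (e : Edge d) (l : List (Edge d)) (hl : (e :: l).length = m + 1)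
    (hc : (e :: l).IsChain adjE) : e :: l ∈ chains m e := by
  induction m generalizing e l with
  | zero =>
    have : l = [] := by simpa using hl
    subst this; simp [chains]
  | succ m ih =>
    cases l with
    | nil => simp at hl
    | cons a l =>
      rw [chains, Finset.mem_biUnion]
      rw [List.isChain_cons_cons] at hc
      refine ⟨a, mem_nbrs.2 hc.1, Finset.mem_image.2 ⟨a :: l, ih a l (by simpa using hl) hc.2, rfl⟩⟩

lemma exists_chain (T : Finset (Edge d)) (hT : EConn T) (e : Edge d) (he : e ∈ T) (m : ℕ)
    (hm : m + 1 ≤ T.card) : ∃ l : List (Edge d), (e :: l).length = 2 * m + 1 ∧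
      (e :: l).IsChain adjE ∧ (e :: l).toFinset ⊆ T ∧ (e :: l).toFinset.card = m + 1 := by
  induction m with
  | zero => exact ⟨[], by simp, by simp, by simpa using he, by simp⟩
  | succ m ih =>
    obtain ⟨l, h1, h2, h3, h4⟩ := ih (by omega)
    have hne : (e :: l).toFinset ≠ T := fun h => by rw [h] at h4; omega
    have := mt (hT _ h3 ⟨e, by simp⟩) hne
    push Not at this
    obtain ⟨a, ha, b, hb, hab, hbn⟩ := this
    rw [List.mem_toFinset] at ha hbn
    obtain ⟨s, t, hst⟩ := List.append_of_mem ha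
    have hset : ∀ l', e :: l' = s ++ a :: b :: a :: t →
        (e :: l').toFinset = insert b (e :: l).toFinset := by
      intro l' hl'
      rw [hl', hst]; ext z; simp
    have hfin : ∃ l', e :: l' = s ++ a :: b :: a :: t := by
      cases s with
      | nil => simp at hst; exact ⟨b :: a :: t, by simp [hst.1]⟩
      | cons c s => simp at hst; exact ⟨s ++ a :: b :: a :: t, by simp [hst.1]⟩
    obtain ⟨l', hl'⟩ := hfin
    refine ⟨l', ?_, ?_, ?_, ?_⟩
    · rw [hl']; rw [hst] at h1; simp at h1 ⊢; omega
    · rw [hl']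
      rw [hst] at h2
      have hba := adjE_symm hab
      rw [List.isChain_append] at h2 ⊢
      refine ⟨h2.1, ?_, ?_⟩
      · simp only [List.isChain_cons_cons]; exact ⟨hab, hba, h2.2.1⟩
      · simpa using h2.2.2
    · rw [hset l' hl']; exact Finset.insert_subset hb h3
    · rw [hset l' hl', Finset.card_insert_of_notMem (by simpa using hbn), h4]

lemma conn_mem_image (T : Finset (Edge d)) (hT : EConn T) (e : Edge d) (he : e ∈ T) :
    T ∈ (chains (2 * (T.card - 1)) e).image List.toFinset := by
  have hpos : 0 < T.card := Finset.card_pos.2 ⟨e, he⟩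
  obtain ⟨l, h1, h2, h3, h4⟩ := exists_chain T hT e he (T.card - 1) (by omega)
  refine Finset.mem_image.2 ⟨e :: l, mem_chains _ _ _ h1 h2, ?_⟩
  exact Finset.eq_of_subset_of_card_le h3 (by omega)

/-- point on the ray in direction `i` -/
lemma ray_exits (S : Finset (V d)) (x w : V d) (hw : w ≠ 0) (hx : x ∈ S) :
    ∃ k : ℕ, x + (k:ℤ) • w ∈ S ∧ x + ((k + 1 : ℕ) : ℤ) • w ∉ S := by
  by_contra hcon
  push Not at hcon
  have hall : ∀ k : ℕ, x + (k:ℤ) • w ∈ S := by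
    intro k
    induction k with
    | zero => simpa using hx
    | succ k ih => exact hcon k ih
  have hinj : Function.Injective (fun k : ℕ => x + (k:ℤ) • w) := by
    intro a b hab
    have h1 : (a:ℤ) • w = (b:ℤ) • w := by simpa using hab
    have := smul_left_injective ℤ hw h1
    exact_mod_cast this
  have : Set.Finite (Set.univ : Set ℕ) := by
    refine Set.Finite.of_finite_image (f := fun k : ℕ => x + (k:ℤ) • w)
      (S.finite_toSet.subset ?_) hinj.injOn
    rintro _ ⟨k, -, rfl⟩; exact hall k
  exact Set.infinite_univ this

lemma ee_ne_zero (i : Fin d) : (ee i : V d) ≠ 0 := by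
  intro h
  have := congrFun h i
  simp [ee] at this

lemma bd_empty {S : Finset (V d)} (i : Fin d) (h : bd S = ∅) : S = ∅ := by
  by_contra hne
  obtain ⟨x, hx⟩ := Finset.nonempty_iff_ne_empty.2 hne
  obtain ⟨k, h1, h2⟩ := ray_exits S x (ee i) (ee_ne_zero i) hx
  have : (x + (k:ℤ) • ee i, i) ∈ bd S := by
    rw [mem_bd]
    have : tip (x + (k:ℤ) • ee i, i) = x + ((k + 1 : ℕ):ℤ) • ee i := by
      simp only [tip]; push_cast; rw [add_smul, one_smul, add_assoc]
    rw [this]; tauto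
  rw [h] at this; simp at this

lemma bd_inj (i : Fin d) {S S' : Finset (V d)} (h : bd S = bd S') : S = S' := by
  have h0 : bd ((S \ S') ∪ (S' \ S)) = ∅ := by
    ext e
    have := Finset.ext_iff.1 h e
    simp only [mem_bd, Finset.mem_sdiff, Finset.mem_union] at this ⊢
    simp only [Finset.notMem_empty, iff_false]
    clear * - this
    revert this
    by_cases a1 : e.1 ∈ S <;> by_cases a2 : e.1 ∈ S' <;> by_cases a3 : tip e ∈ S <;>
      by_cases a4 : tip e ∈ S' <;> simp [a1, a2, a3, a4]
  have h1 := bd_empty i h0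
  rw [Finset.union_eq_empty, Finset.sdiff_eq_empty_iff_subset,
    Finset.sdiff_eq_empty_iff_subset] at h1
  exact h1.1.antisymm h1.2

lemma exists_root (i : Fin d) (S : Finset (V d)) (x : V d) (hx : x ∈ S) (hc : EConn (bd S)) :
    ∃ k < (bd S).card, (x + (k:ℤ) • ee i, i) ∈ bd S := by
  obtain ⟨k, h1, h2⟩ := ray_exits S x (ee i) (ee_ne_zero i) hx
  have hk : (x + (k:ℤ) • ee i, i) ∈ bd S := by
    rw [mem_bd]
    have : tip (x + (k:ℤ) • ee i, i) = x + ((k + 1 : ℕ):ℤ) • ee i := by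
      simp only [tip]; push_cast; rw [add_smul, one_smul, add_assoc]
    rw [this]; tauto
  obtain ⟨k', h1', h2'⟩ := ray_exits S x (-ee i) (neg_ne_zero.2 (ee_ne_zero i)) hx
  have hk' : (x + ((k' + 1 : ℕ):ℤ) • (-ee i), i) ∈ bd S := by
    rw [mem_bd]
    have : tip (x + ((k' + 1 : ℕ):ℤ) • (-ee i), i) = x + (k':ℤ) • (-ee i) := by
      simp only [tip]; push_cast; module
    rw [this]; tauto
  refine ⟨k, ?_, hk⟩
  have hsub : Finset.Icc (x i) (x i + k) ⊆ (bd S).image (fun e => e.1 i) := by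
    intro t ht
    rw [Finset.mem_Icc] at ht
    by_contra hno
    have hno' : ∀ e ∈ bd S, e.1 i ≠ t := fun e he h => hno (Finset.mem_image.2 ⟨e, he, h⟩)
    have hU := hc ((bd S).filter (fun e => e.1 i < t)) (Finset.filter_subset _ _)
      ⟨_, Finset.mem_filter.2 ⟨hk', by simp [ee]; omega⟩⟩ (by
        intro a ha b hb hab
        rw [Finset.mem_filter] at ha ⊢
        refine ⟨hb, ?_⟩
        have := hab i
        rw [abs_le] at this
        have := hno' b hb
        omega)
    have := hU ▸ hk
    rw [← hU, Finset.mem_filter] at hk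
    have := hk.2
    simp [ee] at this
    omega
  have := (Finset.card_le_card hsub).trans Finset.card_image_le
  rw [Int.card_Icc] at this
  omega

/-- Counting: number of contours. -/
lemma count_bd (i : Fin d) (x : V d) (F : Finset (Finset (V d)))
    (hF : ∀ S ∈ F, x ∈ S ∧ EConn (bd S)) (n : ℕ) :
    (F.filter (fun S => (bd S).card = n)).card ≤ n * DD d ^ (2 * (n - 1)) := by
  have h1 : (F.filter (fun S => (bd S).card = n)).card ≤
      ((Finset.range n).biUnion fun k =>
        (chains (2 * (n - 1)) (x + (k:ℤ) • ee i, i)).image List.toFinset).card := by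
    refine Finset.card_le_card_of_injOn bd ?_ ?_
    · intro S hS
      rw [Finset.mem_coe, Finset.mem_filter] at hS
      obtain ⟨hSF, hn⟩ := hS
      obtain ⟨k, hk, hke⟩ := exists_root i S x (hF S hSF).1 (hF S hSF).2
      rw [Finset.mem_coe, Finset.mem_biUnion]
      refine ⟨k, by rw [Finset.mem_range]; omega, ?_⟩
      have := conn_mem_image (bd S) (hF S hSF).2 _ hke
      rwa [hn] at this
    · intro S _ S' _ h; exact bd_inj i h
  refine h1.trans (Finset.card_biUnion_le.trans ?_)
  refine (Finset.sum_le_sum (fun k _ => Finset.card_image_le.trans (card_chains _ _))).trans ?_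
  simp

lemma sum_contours (i : Fin d) (x : V d) (F : Finset (Finset (V d)))
    (hF : ∀ S ∈ F, x ∈ S ∧ EConn (bd S)) (q : ℝ) (hq : 0 ≤ q)
    (hqD : q * (DD d : ℝ) ^ 2 ≤ 1 / 16) : ∑ S ∈ F, q ^ (bd S).card ≤ 1 / 3 := by
  have hD1 : (1:ℝ) ≤ DD d := by
    have : 0 < d := i.pos
    have : 0 < DD d := by unfold DD; positivity
    exact_mod_cast this
  obtain ⟨M, hM⟩ : ∃ M, ∀ S ∈ F, (bd S).card < M :=
    ⟨F.sup (fun S => (bd S).card) + 1, fun S hS =>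
      Nat.lt_succ_of_le (Finset.le_sup (f := fun S => (bd S).card) hS)⟩
  rw [← Finset.sum_fiberwise_of_maps_to (s := F) (t := Finset.range M)
    (g := fun S => (bd S).card) (fun S hS => Finset.mem_range.2 (hM S hS))]
  have hterm : ∀ n ∈ Finset.range M, ∑ S ∈ F.filter (fun S => (bd S).card = n), q ^ (bd S).card
      ≤ (if n = 0 then 0 else (1/8 : ℝ) ^ n) := by
    intro n _
    have h1 : ∑ S ∈ F.filter (fun S => (bd S).card = n), q ^ (bd S).card
        = (F.filter (fun S => (bd S).card = n)).card * q ^ n := by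
      rw [← nsmul_eq_mul, ← Finset.sum_const]
      refine Finset.sum_congr rfl fun S hS => ?_
      rw [(Finset.mem_filter.1 hS).2]
    rw [h1]
    have h2 := count_bd i x F hF n
    split_ifs with hn
    · subst hn
      have : (F.filter (fun S => (bd S).card = 0)).card = 0 := by simpa using h2
      rw [this, Nat.cast_zero, zero_mul]
    · have h3 : ((F.filter (fun S => (bd S).card = n)).card : ℝ) ≤ n * (DD d : ℝ) ^ (2 * (n - 1)) := by
        exact_mod_cast h2
      have h4 : (DD d : ℝ) ^ (2 * (n - 1)) ≤ (DD d : ℝ) ^ (2 * n) :=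
        pow_le_pow_right₀ hD1 (by omega)
      have h5 : (n : ℝ) ≤ 2 ^ n := by exact_mod_cast Nat.lt_two_pow_self.le
      calc ((F.filter (fun S => (bd S).card = n)).card : ℝ) * q ^ n
          ≤ (2 ^ n * (DD d : ℝ) ^ (2 * n)) * q ^ n := by
            gcongr
            exact h3.trans (by gcongr)
        _ = (2 * (q * (DD d : ℝ) ^ 2)) ^ n := by
            rw [pow_mul, mul_pow, mul_pow]; ring
        _ ≤ (1/8) ^ n := by
            gcongr
            linarith
  refine (Finset.sum_le_sum hterm).trans ?_
  have h6 : ∀ M : ℕ, ∑ n ∈ Finset.range M, (if n = 0 then 0 else (1/8 : ℝ) ^ n) ≤ 1/3 - (1/8)^M * (8/7) ∨ M = 0 := by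
    intro M
    induction M with
    | zero => right; rfl
    | succ M ih =>
      left
      rw [Finset.sum_range_succ]
      rcases Nat.eq_zero_or_pos M with rfl | hM
      · norm_num
      · rcases ih with ih | ih
        · rw [if_neg hM.ne', pow_succ]
          have : (0:ℝ) < (1/8)^M := by positivity
          linarith
        · omega
  rcases h6 M with h | h
  · have : (0:ℝ) < (1/8)^M := by positivity
    linarith
  · subst h; norm_num

lemma local_fill {Φ : Interaction d} (hl : IsLocal Φ) (Λ : Finset (V d)) (ω : Config d) :
    Φ Λ ω = Φ Λ (fill Λ (fun x => ω x) plusC) :=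
  hl Λ _ _ fun x hx => by simp [fill, hx]

lemma bdd_local {Φ : Interaction d} (hl : IsLocal Φ) (Λ : Finset (V d)) :
    BddAbove (Set.range fun ω : Config d => |Φ Λ ω|) := by
  have : (Set.range fun ω : Config d => |Φ Λ ω|) ⊆
      Set.range (fun f : ↥Λ → Bool => |Φ Λ (fill Λ f plusC)|) := by
    rintro _ ⟨ω, rfl⟩
    exact ⟨fun x => ω x, by simp only [← local_fill hl Λ ω]⟩
  exact ((Set.finite_range _).subset this).bddAbove

lemma abs_le_supNorm {Φ : Interaction d} (hl : IsLocal Φ) (Λ : Finset (V d)) (ω : Config d) :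
    |Φ Λ ω| ≤ supNorm Φ Λ := le_ciSup (bdd_local hl Λ) ω

lemma supNorm_nonneg (Φ : Interaction d) (Λ : Finset (V d)) : 0 ≤ supNorm Φ Λ :=
  Real.iSup_nonneg fun _ => abs_nonneg _

lemma translate_surj (a : V d) : Function.Surjective (translate a) := fun ω =>
  ⟨translate (-a) ω, by funext x; simp [translate]⟩

/-- shift of finite sets -/
def shiftE (a : V d) : Finset (V d) ≃ Finset (V d) where
  toFun Λ := Λ.image (fun x => x - a)
  invFun Λ := Λ.image (fun x => x + a)
  left_inv Λ := by dsimp only; rw [Finset.image_image]; simp [Function.comp_def]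
  right_inv Λ := by dsimp only; rw [Finset.image_image]; simp [Function.comp_def]

lemma mem_shiftE {a x : V d} {Λ : Finset (V d)} : x ∈ shiftE a Λ ↔ x + a ∈ Λ := by
  simp only [shiftE, Equiv.coe_fn_mk, Finset.mem_image]
  constructor
  · rintro ⟨y, hy, rfl⟩; simpa using hy
  · intro h; exact ⟨_, h, by simp⟩

lemma supNorm_shift {Φ : Interaction d} (ht : TransInv Φ) (a : V d) (Λ : Finset (V d)) :
    supNorm Φ (shiftE a Λ) = supNorm Φ Λ := by
  unfold supNorm
  rw [← (translate_surj a).iSup_comp]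
  exact iSup_congr fun ω => by rw [← ht a Λ ω]; rfl

lemma hasSum_at {Φ : Interaction d} (ht : TransInv Φ) (hs : AbsSummable Φ) (x : V d) :
    HasSum (fun Δ => if x ∈ Δ then supNorm Φ Δ else 0) (anorm Φ) := by
  have h : HasSum (normTerm Φ ∘ shiftE x) (anorm Φ) :=
    (shiftE x).hasSum_iff.2 (Summable.hasSum hs)
  convert h using 1
  funext Δ
  simp [normTerm, mem_shiftE, supNorm_shift ht]

/-- summable bound for the Hamiltonian terms -/
def hbound (Φ : Interaction d) (Λ : Finset (V d)) (Δ : Finset (V d)) : ℝ :=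
  ∑ x ∈ Λ, if x ∈ Δ then supNorm Φ Δ else 0

lemma summable_hbound {Φ : Interaction d} (ht : TransInv Φ) (hs : AbsSummable Φ)
    (Λ : Finset (V d)) : Summable (hbound Φ Λ) :=
  summable_sum fun x _ => (hasSum_at ht hs x).summable

lemma hterm_le {Φ : Interaction d} (hl : IsLocal Φ) (Λ Δ : Finset (V d)) (ω : Config d) :
    ‖(if (Δ ∩ Λ).Nonempty then Φ Δ ω else 0)‖ ≤ hbound Φ Λ Δ := by
  have hnn : ∀ x ∈ Λ, (0:ℝ) ≤ if x ∈ Δ then supNorm Φ Δ else 0 := fun x _ => by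
    split_ifs
    · exact supNorm_nonneg _ _
    · exact le_rfl
  split_ifs with h
  · obtain ⟨x, hx⟩ := h
    rw [Finset.mem_inter] at hx
    refine (abs_le_supNorm hl Δ ω).trans ?_
    have := Finset.single_le_sum hnn hx.2
    rwa [if_pos hx.1] at this
  · rw [norm_zero]; exact Finset.sum_nonneg hnn

lemma summable_ham {Φ : Interaction d} (hl : IsLocal Φ) (ht : TransInv Φ) (hs : AbsSummable Φ)
    (Λ : Finset (V d)) (ω : Config d) :
    Summable (fun Δ : Finset (V d) => if (Δ ∩ Λ).Nonempty then Φ Δ ω else 0) :=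
  Summable.of_norm_bounded (summable_hbound ht hs Λ) fun Δ => hterm_le hl Λ Δ ω

lemma continuous_local {Φ : Interaction d} (hl : IsLocal Φ) (Λ : Finset (V d)) :
    Continuous (Φ Λ) := by
  have : Φ Λ = (fun f : ↥Λ → Bool => Φ Λ (fill Λ f plusC)) ∘ (fun ω x => ω x) := by
    funext ω; exact local_fill hl Λ ω
  rw [this]
  exact continuous_of_discreteTopology.comp (continuous_pi fun x => continuous_apply _)

lemma continuous_ham {Φ : Interaction d} (hl : IsLocal Φ) (ht : TransInv Φ) (hs : AbsSummable Φ)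
    (Λ : Finset (V d)) : Continuous (ham Φ Λ) := by
  refine continuous_tsum (fun Δ => ?_) (summable_hbound ht hs Λ) fun Δ ω => hterm_le hl Λ Δ ω
  split_ifs
  · exact continuous_local hl Δ
  · exact continuous_const

lemma continuous_fill (Λ : Finset (V d)) (f : ↥Λ → Bool) : Continuous (fill Λ f) := by
  refine continuous_pi fun x => ?_
  by_cases h : x ∈ Λ
  · simp only [fill, h, dif_pos]; exact continuous_const
  · simp only [fill, h, dif_neg, not_false_eq_true]; exact continuous_apply x

lemma gibbsZ_pos (Φ : Interaction d) (Λ : Finset (V d)) (η : Config d) : 0 < gibbsZ Φ Λ η :=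
  Finset.sum_pos (fun _ _ => Real.exp_pos _) Finset.univ_nonempty

lemma continuous_finGibbs {Φ : Interaction d} (hl : IsLocal Φ) (ht : TransInv Φ)
    (hs : AbsSummable Φ) (Λ : Finset (V d)) (f : ↥Λ → Bool) :
    Continuous (fun η => finGibbs Φ Λ η f) := by
  have h : ∀ g : ↥Λ → Bool, Continuous fun η => Real.exp (-(ham Φ Λ (fill Λ g η))) := fun g =>
    Real.continuous_exp.comp ((continuous_ham hl ht hs Λ).comp (continuous_fill Λ g)).neg
  refine (h f).div (continuous_finsetSum _ fun g _ => h g) fun η => (gibbsZ_pos Φ Λ η).ne'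

lemma finGibbs_nonneg (Φ : Interaction d) (Λ : Finset (V d)) (η : Config d) (f : ↥Λ → Bool) :
    0 ≤ finGibbs Φ Λ η f := div_nonneg (Real.exp_pos _).le (gibbsZ_pos Φ Λ η).le

lemma sum_finGibbs (Φ : Interaction d) (Λ : Finset (V d)) (η : Config d) :
    ∑ f, finGibbs Φ Λ η f = 1 := by
  simp only [finGibbs]
  rw [← Finset.sum_div]
  exact div_self (gibbsZ_pos Φ Λ η).ne'

/-! Ising interaction -/

lemma ising_local (β : ℝ) : IsLocal (ising β : Interaction d) := by
  intro Λ ω ω' h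
  simp only [ising]
  rw [Finset.prod_congr rfl fun x hx => by rw [h x hx]]

lemma dist1_sub (x y a : V d) : dist1 (x - a) (y - a) = dist1 x y := by simp [dist1]

lemma ising_transInv (β : ℝ) : TransInv (ising β : Interaction d) := by
  intro a Λ ω
  have hinj : Function.Injective (fun x : V d => x - a) := sub_left_injective
  simp only [ising]
  rw [Finset.card_image_of_injective _ hinj, Finset.prod_image hinj.injOn]
  simp only [Finset.forall_mem_image, dist1_sub, translate, sub_add_cancel, ne_eq,
    sub_left_inj]

lemma natAbs_le_dist1 (x y : V d) (i : Fin d) : (x i - y i).natAbs ≤ dist1 x y :=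
  Finset.single_le_sum (f := fun i => (x i - y i).natAbs) (fun _ _ => Nat.zero_le _)
    (Finset.mem_univ i)

lemma ising_summable (β : ℝ) : AbsSummable (ising β : Interaction d) := by
  refine summable_of_ne_finset_zero (s := (box d 1).powerset) fun Λ hΛ => ?_
  simp only [normTerm]
  split_ifs with h0
  · have : ∀ ω : Config d, ising β Λ ω = 0 := by
      intro ω
      simp only [ising]
      rw [if_neg]
      rintro ⟨-, h⟩
      apply hΛ
      rw [Finset.mem_powerset]
      intro x hx
      rw [mem_box]
      intro i
      by_cases hx0 : x = 0
      · subst hx0; simp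
      · have h1 := h x hx 0 h0 hx0
        have h2 := natAbs_le_dist1 x 0 i
        simp only [Pi.zero_apply, sub_zero] at h2
        rw [h1] at h2
        rw [Int.abs_eq_natAbs]; exact_mod_cast h2
    simp [supNorm, this]
  · rfl

lemma iadd_local {Φ Ψ : Interaction d} (h1 : IsLocal Φ) (h2 : IsLocal Ψ) : IsLocal (Iadd Φ Ψ) :=
  fun Λ ω ω' h => by simp only [Iadd]; rw [h1 Λ ω ω' h, h2 Λ ω ω' h]

lemma iadd_transInv {Φ Ψ : Interaction d} (h1 : TransInv Φ) (h2 : TransInv Ψ) :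
    TransInv (Iadd Φ Ψ) :=
  fun a Λ ω => by simp only [Iadd]; rw [h1 a Λ ω, h2 a Λ ω]

lemma iadd_summable {Φ Ψ : Interaction d} (l1 : IsLocal Φ) (l2 : IsLocal Ψ) (h1 : AbsSummable Φ)
    (h2 : AbsSummable Ψ) : AbsSummable (Iadd Φ Ψ) := by
  refine Summable.of_nonneg_of_le (fun Λ => ?_) (fun Λ => ?_) (Summable.add h1 h2)
  · simp only [normTerm]; split_ifs
    · exact supNorm_nonneg _ _
    · exact le_rfl
  · simp only [normTerm]; split_ifs
    · refine ciSup_le fun ω => (abs_add_le _ _).trans ?_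
      exact add_le_add (abs_le_supNorm l1 Λ ω) (abs_le_supNorm l2 Λ ω)
    · simp

lemma spin_not (b : Bool) : spin (!b) = - spin b := by cases b <;> simp [spin]

lemma ising_flip (β : ℝ) : SpinFlipSymm (ising β : Interaction d) := by
  intro Λ ω
  simp only [ising]
  by_cases h : Λ.card = 2 ∧ ∀ x ∈ Λ, ∀ y ∈ Λ, x ≠ y → dist1 x y = 1
  · rw [if_pos h, if_pos h]
    simp only [spin_not, Finset.prod_neg, h.1]
    norm_num
  · rw [if_neg h, if_neg h]

lemma dist1_ee (x : V d) (i : Fin d) : dist1 x (x + ee i) = 1 := by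
  simp only [dist1, Pi.add_apply, sub_add_cancel_left, Int.natAbs_neg, ee]
  rw [Finset.sum_eq_single i]
  · simp
  · intro j _ hj; simp [hj]
  · simp

lemma dist1_comm (x y : V d) : dist1 x y = dist1 y x := by
  simp only [dist1]
  refine Finset.sum_congr rfl fun i _ => ?_
  omega

lemma dist1_one {x y : V d} (h : dist1 x y = 1) : ∃ i, y = x + ee i ∨ x = y + ee i := by
  have hne : ∃ i, (x i - y i).natAbs ≠ 0 := by
    by_contra hcon
    push Not at hcon
    simp [dist1, hcon] at h
  obtain ⟨i, hi⟩ := hne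
  have hsum : (x i - y i).natAbs + ∑ j ∈ Finset.univ.erase i, (x j - y j).natAbs = 1 := by
    rw [← h, dist1, Finset.add_sum_erase _ (fun j => (x j - y j).natAbs) (Finset.mem_univ i)]
  have hz : ∑ j ∈ Finset.univ.erase i, (x j - y j).natAbs = 0 := by omega
  have hz' : ∀ j, j ≠ i → x j = y j := by
    intro j hj
    have := (Finset.sum_eq_zero_iff.1 hz) j (by simp [hj])
    omega
  refine ⟨i, ?_⟩
  rcases Int.natAbs_eq (x i - y i) with h1 | h1
  · right
    funext j
    by_cases hj : j = i
    · subst hj; simp [ee]; omega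
    · simp [ee, hj, hz' j hj]
  · left
    funext j
    by_cases hj : j = i
    · subst hj; simp [ee]; omega
    · simp [ee, hj, hz' j hj]

/-- the unordered edge -/
def edg (e : Edge d) : Finset (V d) := {e.1, tip e}

lemma tip_ne (e : Edge d) : e.1 ≠ tip e := by
  intro h
  have : ee e.2 = 0 := by simpa [tip] using h
  exact ee_ne_zero _ this

lemma edg_inj {e e' : Edge d} (h : edg e = edg e') : e = e' := by
  have h1 : e.1 ∈ edg e' := h ▸ (by simp [edg])
  have h2 : tip e ∈ edg e' := h ▸ (by simp [edg])
  have hn := tip_ne e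
  simp only [edg, Finset.mem_insert, Finset.mem_singleton] at h1 h2
  obtain ⟨x, i⟩ := e
  obtain ⟨y, j⟩ := e'
  simp only [tip] at h1 h2 hn
  rcases h1 with rfl | rfl
  · rcases h2 with h2 | h2
    · exact absurd h2.symm hn
    · have h3 := add_left_cancel h2
      have h4 := congrFun h3 j
      by_cases hij : j = i
      · rw [hij]
      · simp [ee, hij] at h4
  · rcases h2 with h2 | h2
    · exfalso
      have h3 : (ee j + ee i : V d) = 0 := by simpa [add_assoc] using h2
      have h4 := congrFun h3 i
      have := ee_01 j i
      simp [ee] at h4 this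
      omega
    · exact absurd h2.symm hn

lemma spin_mul_of_ne {a b : Bool} (h : a ≠ b) : spin a * spin b = -1 := by
  cases a <;> cases b <;> simp [spin] at h ⊢

lemma spin_sq (a : Bool) : spin a * spin a = 1 := by
  cases a <;> simp [spin]

lemma ising_edg (β : ℝ) (e : Edge d) (ω : Config d) :
    ising β (edg e) ω = -β * (spin (ω e.1) * spin (ω (tip e))) := by
  have hn := tip_ne e
  simp only [ising]
  rw [if_pos]
  · rw [edg, Finset.prod_pair hn]
  · refine ⟨Finset.card_pair hn, ?_⟩
    have h1 : dist1 e.1 (tip e) = 1 := dist1_ee _ _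
    simp only [edg, Finset.mem_insert, Finset.mem_singleton]
    rintro x (rfl | rfl) y (rfl | rfl) hxy
    · exact absurd rfl hxy
    · exact h1
    · rw [dist1_comm]; exact h1
    · exact absurd rfl hxy

lemma crossing {S : Finset (V d)} {x y : V d} (hx : x ∈ S) (hy : y ∉ S) (h : dist1 x y = 1) :
    ∃ e ∈ bd S, edg e = {x, y} ∧ (e.1 = x ∨ e.1 = y) := by
  obtain ⟨i, h | h⟩ := dist1_one h
  · refine ⟨(x, i), ?_, ?_, Or.inl rfl⟩
    · rw [mem_bd]; simp only [tip]; rw [← h]; tauto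
    · simp only [edg, tip]; rw [← h]
  · refine ⟨(y, i), ?_, ?_, Or.inr rfl⟩
    · rw [mem_bd]; simp only [tip]; rw [← h]; tauto
    · simp only [edg, tip]; rw [← h, Finset.pair_comm]

lemma ising_diff (β : ℝ) (Λ S : Finset (V d)) (hS : S ⊆ Λ) (ω : Config d)
    (hω : ∀ e ∈ bd S, ω e.1 ≠ ω (tip e)) (Δ : Finset (V d)) :
    (if (Δ ∩ Λ).Nonempty then ising β Δ ω - ising β Δ (flipOn S ω) else 0)
      = ∑ e ∈ bd S, if Δ = edg e then 2 * β else 0 := by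
  classical
  by_cases hex : ∃ e ∈ bd S, Δ = edg e
  · obtain ⟨e, he, rfl⟩ := hex
    rw [Finset.sum_eq_single e, if_pos rfl]
    · have hm := mem_bd.1 he
      rw [if_pos, ising_edg, ising_edg, spin_mul_of_ne (hω e he)]
      · have : flipOn S ω e.1 = flipOn S ω (tip e) := by
          have := hω e he
          simp only [flipOn]
          by_cases h1 : e.1 ∈ S <;> by_cases h2 : tip e ∈ S
          · tauto
          · simp only [h1, h2, if_true, if_false]; revert this; cases ω e.1 <;> simp
          · simp only [h1, h2, if_true, if_false]; revert this; cases ω e.1 <;> simp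
          · tauto
        rw [this, spin_sq]; ring
      · by_cases h1 : e.1 ∈ S
        · exact ⟨e.1, by simp [edg, hS h1]⟩
        · have h2 : tip e ∈ S := by tauto
          exact ⟨tip e, by simp [edg, hS h2]⟩
    · intro e' _ hne
      rw [if_neg]; intro h; exact hne (edg_inj h.symm)
    · intro h; exact absurd he h
  · push Not at hex
    rw [Finset.sum_eq_zero fun e he => if_neg (hex e he)]
    split_ifs with hne
    · simp only [ising]
      by_cases hc : Δ.card = 2 ∧ ∀ x ∈ Δ, ∀ y ∈ Δ, x ≠ y → dist1 x y = 1
      · rw [if_pos hc, if_pos hc]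
        obtain ⟨h2, hd1⟩ := hc
        obtain ⟨x, y, hxy, rfl⟩ := Finset.card_eq_two.1 h2
        have h1 := hd1 x (by simp) y (by simp) hxy
        rw [Finset.prod_pair hxy, Finset.prod_pair hxy]
        simp only [flipOn]
        by_cases hx : x ∈ S <;> by_cases hy : y ∈ S
        · simp only [hx, hy, if_true, spin_not]; ring
        · obtain ⟨e, he, h, -⟩ := crossing hx hy h1
          exact absurd h.symm (hex e he)
        · rw [dist1_comm] at h1
          obtain ⟨e, he, h, -⟩ := crossing hy hx h1
          rw [Finset.pair_comm] at h
          exact absurd h.symm (hex e he)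
        · simp only [hx, hy, if_false]; ring
      · rw [if_neg hc, if_neg hc, sub_zero]
    · rfl

lemma psi_diff {Ψ : Interaction d} (hl : IsLocal Ψ) (hf : SpinFlipSymm Ψ) (hz : ZeroOnNonConn Ψ)
    (Λ S : Finset (V d)) (ω : Config d) (Δ : Finset (V d)) :
    |(if (Δ ∩ Λ).Nonempty then Ψ Δ ω - Ψ Δ (flipOn S ω) else 0)|
      ≤ ∑ e ∈ bd S, 2 * (if e.1 ∈ Δ then supNorm Ψ Δ else 0) := by
  have hnn : ∀ e ∈ bd S, (0:ℝ) ≤ 2 * (if e.1 ∈ Δ then supNorm Ψ Δ else 0) := fun x _ => by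
    split_ifs
    · have := supNorm_nonneg Ψ Δ; positivity
    · simp
  have h0 := Finset.sum_nonneg hnn
  split_ifs with hne
  swap
  · simpa using h0
  by_cases h1 : ∀ x ∈ Δ, x ∈ S
  · have : Ψ Δ (flipOn S ω) = Ψ Δ ω := by
      rw [← hf Δ ω]
      exact hl _ _ _ fun x hx => by simp [flipOn, h1 x hx]
    rw [this, sub_self, abs_zero]; exact h0
  by_cases h2 : ∀ x ∈ Δ, x ∉ S
  · have : Ψ Δ (flipOn S ω) = Ψ Δ ω := hl _ _ _ fun x hx => by simp [flipOn, h2 x hx]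
    rw [this, sub_self, abs_zero]; exact h0
  by_cases hc : Conn1 (↑Δ : Set (V d))
  swap
  · rw [hz Δ hc, hz Δ hc, sub_self, abs_zero]; exact h0
  push Not at h1 h2
  obtain ⟨b, hbΔ, hb⟩ := h1
  obtain ⟨a, haΔ, ha⟩ := h2
  obtain ⟨n, p, hp0, hpn, hpΔ, hstep⟩ := hc a haΔ b hbΔ
  have hex : ∃ i < n, p i ∈ S ∧ p (i + 1) ∉ S := by
    by_contra hcon
    push Not at hcon
    have : ∀ i ≤ n, p i ∈ S := by
      intro i
      induction i with
      | zero => intro _; rwa [hp0]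
      | succ i ih => intro hi; exact hcon i (by omega) (ih (by omega))
    exact hb (hpn ▸ this n le_rfl)
  obtain ⟨i, hin, hi1, hi2⟩ := hex
  obtain ⟨e, he, -, hor⟩ := crossing hi1 hi2 (hstep i hin)
  have heΔ : e.1 ∈ Δ := by
    rcases hor with h | h
    · rw [h]; exact hpΔ i hin.le
    · rw [h]; exact hpΔ (i + 1) hin
  have hs := Finset.single_le_sum hnn he
  rw [if_pos heΔ] at hs
  refine le_trans ?_ hs
  refine (abs_sub _ _).trans ?_
  have := abs_le_supNorm hl Δ ω
  have := abs_le_supNorm hl Δ (flipOn S ω)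
  linarith

lemma energy (β : ℝ) {Ψ : Interaction d} (hl : IsLocal Ψ) (ht : TransInv Ψ) (hf : SpinFlipSymm Ψ)
    (hz : ZeroOnNonConn Ψ) (hs : AbsSummable Ψ) (Λ S : Finset (V d)) (hS : S ⊆ Λ) (ω : Config d)
    (hω : ∀ e ∈ bd S, ω e.1 ≠ ω (tip e)) :
    (bd S).card * (2 * β - 2 * anorm Ψ) ≤
      ham (Iadd (ising β) Ψ) Λ ω - ham (Iadd (ising β) Ψ) Λ (flipOn S ω) := by
  have hΦl : IsLocal (Iadd (ising β) Ψ) := iadd_local (ising_local β) hl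
  have hΦt : TransInv (Iadd (ising β) Ψ) := iadd_transInv (ising_transInv β) ht
  have hΦs : AbsSummable (Iadd (ising β) Ψ) :=
    iadd_summable (ising_local β) hl (ising_summable β) hs
  have h1 := (summable_ham hΦl hΦt hΦs Λ ω).hasSum.sub
    (summable_ham hΦl hΦt hΦs Λ (flipOn S ω)).hasSum
  have h2 : HasSum (fun Δ => ∑ e ∈ bd S, ((if Δ = edg e then 2 * β else 0)
      - 2 * (if e.1 ∈ Δ then supNorm Ψ Δ else 0))) (∑ e ∈ bd S, (2 * β - 2 * anorm Ψ)) := by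
    refine hasSum_sum fun e _ => ?_
    exact (hasSum_ite_eq (edg e) (2 * β)).sub ((hasSum_at ht hs e.1).mul_left 2)
  have h3 := hasSum_le (fun Δ => ?_) h2 h1
  · rw [Finset.sum_const, nsmul_eq_mul] at h3
    exact h3
  · have a1 := ising_diff β Λ S hS ω hω Δ
    have a2 := (abs_le.1 (psi_diff hl hf hz Λ S ω Δ)).1
    rw [Finset.sum_sub_distrib, ← a1]
    simp only [Iadd]
    split_ifs at a2 ⊢ <;> linarith

lemma flip_fill (Λ S : Finset (V d)) (hS : S ⊆ Λ) (f : ↥Λ → Bool) (η : Config d) :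
    fill Λ (fun y => if (y : V d) ∈ S then !(f y) else f y) η = flipOn S (fill Λ f η) := by
  funext x
  simp only [fill, flipOn]
  by_cases h : x ∈ Λ
  · simp [h]
  · have : x ∉ S := fun h' => h (hS h')
    simp [h, this]

lemma contour_bound (β L : ℝ) {Ψ : Interaction d} (hl : IsLocal Ψ) (ht : TransInv Ψ)
    (hf : SpinFlipSymm Ψ) (hz : ZeroOnNonConn Ψ) (hs : AbsSummable Ψ) (hL : L ≤ β - anorm Ψ)
    (Λ S : Finset (V d)) (hS : S ⊆ Λ) (η : Config d) :
    ∑ f : ↥Λ → Bool, (open scoped Classical in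
      if (∀ e ∈ bd S, fill Λ f η e.1 ≠ fill Λ f η (tip e)) then
        Real.exp (-(ham (Iadd (ising β) Ψ) Λ (fill Λ f η))) else 0)
      ≤ Real.exp (-(2 * L)) ^ (bd S).card * gibbsZ (Iadd (ising β) Ψ) Λ η := by
  classical
  have hinv : Function.Involutive (fun (f : ↥Λ → Bool) (y : ↥Λ) =>
      if (y : V d) ∈ S then !(f y) else f y) := by
    intro f; funext y; by_cases h : (y : V d) ∈ S <;> simp [h]
  rw [gibbsZ, ← Equiv.sum_comp (Function.Involutive.toPerm _ hinv)
    (fun f => Real.exp (-(ham (Iadd (ising β) Ψ) Λ (fill Λ f η)))), Finset.mul_sum]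
  refine Finset.sum_le_sum fun f _ => ?_
  split_ifs with h
  · have he := energy β hl ht hf hz hs Λ S hS (fill Λ f η) h
    simp only [Function.Involutive.coe_toPerm]
    rw [flip_fill Λ S hS, ← Real.exp_nat_mul, ← Real.exp_add]
    apply Real.exp_le_exp.2
    have : ((bd S).card : ℝ) * (2 * L) ≤ (bd S).card * (2 * β - 2 * anorm Ψ) := by
      gcongr; linarith
    linarith
  · positivity

lemma peierls (hd : 2 ≤ d) (β L : ℝ) {Ψ : Interaction d} (hl : IsLocal Ψ) (ht : TransInv Ψ)
    (hf : SpinFlipSymm Ψ) (hz : ZeroOnNonConn Ψ) (hs : AbsSummable Ψ) (hL : L ≤ β - anorm Ψ)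
    (hLD : Real.exp (-(2 * L)) * (DD d : ℝ) ^ 2 ≤ 1 / 16) (N : ℕ) (x : V d) :
    ∑ f : ↥(box d N) → Bool, (if fill (box d N) f plusC x = false then
        finGibbs (Iadd (ising β) Ψ) (box d N) plusC f else 0) ≤ 1 / 3 := by
  classical
  set Φ := Iadd (ising β) Ψ
  set Λ := box d N with hΛ
  set F : Finset (Finset (V d)) := Λ.powerset.filter (fun S => x ∈ S ∧ EConn (bd S)) with hF
  have hZ := gibbsZ_pos Φ Λ plusC
  have key : ∑ f : ↥Λ → Bool, (if fill Λ f plusC x = false then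
      Real.exp (-(ham Φ Λ (fill Λ f plusC))) else 0) ≤ 1 / 3 * gibbsZ Φ Λ plusC := by
    calc _ ≤ ∑ f : ↥Λ → Bool, ∑ S ∈ F,
          (if (∀ e ∈ bd S, fill Λ f plusC e.1 ≠ fill Λ f plusC (tip e)) then
            Real.exp (-(ham Φ Λ (fill Λ f plusC))) else 0) := by
          refine Finset.sum_le_sum fun f _ => ?_
          have hnn : ∀ S ∈ F, 0 ≤
            (if (∀ e ∈ bd S, fill Λ f plusC e.1 ≠ fill Λ f plusC (tip e)) then
              Real.exp (-(ham Φ Λ (fill Λ f plusC))) else 0) := by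
            intro S _; split_ifs <;> positivity
          split_ifs with hx
          · set ω := fill Λ f plusC with hω
            set S₀ := Λ.filter (fun y => ω y = false) with hS₀
            have hm : ∀ y, y ∈ S₀ ↔ ω y = false := by
              intro y
              rw [hS₀, Finset.mem_filter]
              refine ⟨fun h => h.2, fun h => ⟨?_, h⟩⟩
              by_contra hy
              simp [hω, fill, hy, plusC] at h
            obtain ⟨S, h1, h2, h3, h4⟩ := exists_conn hd N x _ S₀ rfl
              (Finset.filter_subset _ _) ((hm x).2 hx)
            have hSF : S ∈ F := by
              rw [hF, Finset.mem_filter, Finset.mem_powerset]; exact ⟨h1, h2, h4⟩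
            refine le_trans ?_ (Finset.single_le_sum hnn hSF)
            rw [if_pos]
            intro e he
            have := mem_bd.1 (h3 he)
            rw [hm, hm] at this
            intro h; rw [h] at this; exact this Iff.rfl
          · exact Finset.sum_nonneg hnn
      _ = ∑ S ∈ F, ∑ f : ↥Λ → Bool,
          (if (∀ e ∈ bd S, fill Λ f plusC e.1 ≠ fill Λ f plusC (tip e)) then
            Real.exp (-(ham Φ Λ (fill Λ f plusC))) else 0) := Finset.sum_comm
      _ ≤ ∑ S ∈ F, Real.exp (-(2 * L)) ^ (bd S).card * gibbsZ Φ Λ plusC := by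
          refine Finset.sum_le_sum fun S hS => ?_
          rw [hF, Finset.mem_filter, Finset.mem_powerset] at hS
          convert contour_bound β L hl ht hf hz hs hL Λ S hS.1 plusC
      _ ≤ 1 / 3 * gibbsZ Φ Λ plusC := by
          rw [← Finset.sum_mul]
          refine mul_le_mul_of_nonneg_right ?_ hZ.le
          refine sum_contours ⟨0, by omega⟩ x F (fun S hS => ?_) _ (Real.exp_pos _).le hLD
          rw [hF, Finset.mem_filter] at hS
          exact hS.2
  have : ∑ f : ↥Λ → Bool, (if fill Λ f plusC x = false then finGibbs Φ Λ plusC f else 0)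
      = (∑ f : ↥Λ → Bool, (if fill Λ f plusC x = false then
      Real.exp (-(ham Φ Λ (fill Λ f plusC))) else 0)) / gibbsZ Φ Λ plusC := by
    rw [Finset.sum_div]
    refine Finset.sum_congr rfl fun f _ => ?_
    split_ifs
    · rfl
    · simp
  rw [this, div_le_iff₀ hZ]
  exact key

lemma ham_translate {Φ : Interaction d} (ht : TransInv Φ) (Λ : Finset (V d)) (a : V d)
    (ω : Config d) : ham Φ Λ (translate a ω) =
      ∑' Δ : Finset (V d), if (shiftE a Δ ∩ Λ).Nonempty then Φ Δ ω else 0 := by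
  rw [ham, ← (shiftE a).tsum_eq]
  refine tsum_congr fun Δ => ?_
  rw [show Φ (shiftE a Δ) (translate a ω) = Φ Δ ω from ht a Δ ω]

lemma summable_ham_translate {Φ : Interaction d} (hl : IsLocal Φ) (ht : TransInv Φ)
    (hs : AbsSummable Φ) (Λ : Finset (V d)) (a : V d) (ω : Config d) :
    Summable (fun Δ : Finset (V d) => if (shiftE a Δ ∩ Λ).Nonempty then Φ Δ ω else 0) := by
  have := (shiftE a).summable_iff.2 (summable_ham hl ht hs Λ (translate a ω))
  refine this.congr fun Δ => ?_
  simp only [Function.comp]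
  rw [show Φ (shiftE a Δ) (translate a ω) = Φ Δ ω from ht a Δ ω]

lemma ham_diff {Φ : Interaction d} (hl : IsLocal Φ) (ht : TransInv Φ) (hs : AbsSummable Φ)
    (Λ Λ' : Finset (V d)) (a : V d) (hsub : ∀ y ∈ Λ, y + a ∈ Λ') (ω ω' : Config d)
    (hω : ∀ z, z - a ∉ Λ → ω z = ω' z) :
    ham Φ Λ' ω - ham Φ Λ (translate a ω) = ham Φ Λ' ω' - ham Φ Λ (translate a ω') := by
  rw [ham_translate ht, ham_translate ht, ham, ham,
    ← (summable_ham hl ht hs Λ' ω).tsum_sub (summable_ham_translate hl ht hs Λ a ω),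
    ← (summable_ham hl ht hs Λ' ω').tsum_sub (summable_ham_translate hl ht hs Λ a ω')]
  refine tsum_congr fun Δ => ?_
  by_cases h : (shiftE a Δ ∩ Λ).Nonempty
  · have h' : (Δ ∩ Λ').Nonempty := by
      obtain ⟨y, hy⟩ := h
      rw [Finset.mem_inter, mem_shiftE] at hy
      exact ⟨y + a, Finset.mem_inter.2 ⟨hy.1, hsub y hy.2⟩⟩
    simp [h, h']
  · have : Φ Δ ω = Φ Δ ω' := by
      refine hl _ _ _ fun z hz => hω z fun hz' => h ⟨z - a, ?_⟩
      rw [Finset.mem_inter, mem_shiftE]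
      exact ⟨by simpa using hz, hz'⟩
    rw [this]

lemma fill_fill (Λ : Finset (V d)) (f g : ↥Λ → Bool) (η : Config d) :
    fill Λ f (fill Λ g η) = fill Λ f η := by
  funext x; by_cases h : x ∈ Λ <;> simp [fill, h]

lemma gibbsZ_fill (Φ : Interaction d) (Λ : Finset (V d)) (g : ↥Λ → Bool) (η : Config d) :
    gibbsZ Φ Λ (fill Λ g η) = gibbsZ Φ Λ η := by simp only [gibbsZ, fill_fill]

lemma finGibbs_fill (Φ : Interaction d) (Λ : Finset (V d)) (f g : ↥Λ → Bool) (η : Config d) :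
    finGibbs Φ Λ (fill Λ g η) f = finGibbs Φ Λ η f := by
  simp only [finGibbs, fill_fill, gibbsZ_fill]

lemma fill_restrict (Λ : Finset (V d)) (η : Config d) : fill Λ (fun x => η x) η = η := by
  funext x; by_cases h : x ∈ Λ <;> simp [fill, h]

lemma mem_cyl_iff (Λ : Finset (V d)) (f : ↥Λ → Bool) (ξ : Config d) :
    ξ ∈ cyl Λ f ↔ (fun x : ↥Λ => ξ x) = f := by
  constructor
  · intro h; funext x; exact h x x.2
  · rintro rfl x hx; rfl

/-- finite-volume DLR equation, with a translation -/
lemma dlr_swap {Φ : Interaction d} (hl : IsLocal Φ) (ht : TransInv Φ) (hs : AbsSummable Φ)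
    (Λ Λ' : Finset (V d)) (a : V d) (hsub : ∀ y ∈ Λ, y + a ∈ Λ') (η : Config d) (h : ↥Λ → Bool) :
    ∑ f : ↥Λ' → Bool, finGibbs Φ Λ' η f * (cyl Λ h).indicator 1 (translate a (fill Λ' f η))
      = ∑ f : ↥Λ' → Bool, finGibbs Φ Λ' η f * finGibbs Φ Λ (translate a (fill Λ' f η)) h := by
  classical
  let T : (↥Λ' → Bool) × (↥Λ → Bool) → (↥Λ' → Bool) × (↥Λ → Bool) := fun p =>
    (fun z => if hz : (z : V d) - a ∈ Λ then p.2 ⟨z - a, hz⟩ else p.1 z,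
      fun y => p.1 ⟨y + a, hsub y y.2⟩)
  have hT : Function.Involutive T := by
    rintro ⟨f, k⟩
    simp only [T]
    ext z
    · by_cases hz : (z : V d) - a ∈ Λ
      · simp [hz]
      · simp [hz]
    · simp
  have hTω : ∀ f k, translate a (fill Λ' (T (f, k)).1 η) = fill Λ k (translate a (fill Λ' f η)) := by
    intro f k
    funext y
    by_cases hy : y ∈ Λ
    · simp [translate, fill, T, hsub y hy, hy]
    · simp only [translate, fill, T, hy]
      by_cases hy' : y + a ∈ Λ'
      · simp [hy', hy]
      · simp [hy']
  have hT2 : ∀ f k, (T (f, k)).2 = fun y : ↥Λ => translate a (fill Λ' f η) y := by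
    intro f k; funext y
    simp [T, translate, fill, hsub y y.2]
  have hdiff : ∀ f k, ham Φ Λ' (fill Λ' (T (f, k)).1 η) -
      ham Φ Λ (translate a (fill Λ' (T (f, k)).1 η)) =
      ham Φ Λ' (fill Λ' f η) - ham Φ Λ (translate a (fill Λ' f η)) := by
    intro f k
    refine ham_diff hl ht hs Λ Λ' a hsub _ _ fun z hz => ?_
    by_cases hz' : z ∈ Λ' <;> simp [fill, T, hz, hz']
  have hL : ∀ f : ↥Λ' → Bool,
      finGibbs Φ Λ' η f * (cyl Λ h).indicator 1 (translate a (fill Λ' f η)) =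
      ∑ k : ↥Λ → Bool, finGibbs Φ Λ' η f * (cyl Λ h).indicator 1 (translate a (fill Λ' f η)) *
        finGibbs Φ Λ (translate a (fill Λ' f η)) k := by
    intro f
    rw [← Finset.mul_sum, sum_finGibbs, mul_one]
  have hR : ∀ f : ↥Λ' → Bool,
      finGibbs Φ Λ' η f * finGibbs Φ Λ (translate a (fill Λ' f η)) h =
      ∑ k : ↥Λ → Bool, if k = h then
        finGibbs Φ Λ' η f * finGibbs Φ Λ (translate a (fill Λ' f η)) k else 0 := by
    intro f; simp
  rw [Finset.sum_congr rfl fun f _ => hL f, Finset.sum_congr rfl fun f _ => hR f]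
  rw [← Fintype.sum_prod_type', ← Fintype.sum_prod_type',
    ← Equiv.sum_comp (Function.Involutive.toPerm T hT)]
  refine Finset.sum_congr rfl ?_
  rintro ⟨f, k⟩ -
  simp only [Function.Involutive.coe_toPerm]
  have hind : (cyl Λ h).indicator (1 : Config d → ℝ) (translate a (fill Λ' (T (f, k)).1 η))
      = if k = h then 1 else 0 := by
    rw [hTω, Set.indicator_apply]
    have : fill Λ k (translate a (fill Λ' f η)) ∈ cyl Λ h ↔ k = h := by
      rw [mem_cyl_iff]
      have : (fun x : ↥Λ => fill Λ k (translate a (fill Λ' f η)) x) = k := by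
        funext x; simp [fill]
      rw [this]
    simp [this]
  rw [hind]
  split_ifs with hk
  · rw [mul_one, hTω, finGibbs_fill, hT2]
    have hd := hdiff f k
    rw [hTω] at hd
    simp only [finGibbs]
    rw [fill_restrict]
    rw [div_mul_div_comm, div_mul_div_comm, ← Real.exp_add, ← Real.exp_add]
    congr 2
    linarith
  · simp

lemma exists_prob {X ι : Type*} [MeasurableSpace X] [MeasurableSingletonClass X] [Fintype ι]
    (c : ι → ℝ) (hc : ∀ i, 0 ≤ c i) (hsum : ∑ i, c i = 1) (pt : ι → X) :
    ∃ μ : Measure X, IsProbabilityMeasure μ ∧ ∀ g : X → ℝ, ∫ x, g x ∂μ = ∑ i, c i * g (pt i) := by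
  refine ⟨∑ i, ENNReal.ofReal (c i) • Measure.dirac (pt i), ⟨?_⟩, fun g => ?_⟩
  · simp only [Measure.coe_finsetSum, Finset.sum_apply, Measure.smul_apply, measure_univ,
      smul_eq_mul, mul_one]
    rw [← ENNReal.ofReal_sum_of_nonneg fun i _ => hc i, hsum, ENNReal.ofReal_one]
  · have hintg : ∀ i ∈ Finset.univ, Integrable g (ENNReal.ofReal (c i) • Measure.dirac (pt i)) := by
      intro i _
      refine Integrable.smul_measure ?_ ENNReal.ofReal_ne_top
      exact integrable_dirac (by simp)
    rw [integral_finsetSum_measure hintg]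
    refine Finset.sum_congr rfl fun i _ => ?_
    rw [integral_smul_measure, integral_dirac, ENNReal.toReal_ofReal (hc i), smul_eq_mul]

lemma card_box (n : ℕ) : (box d n).card = (2 * n + 1) ^ d := by
  rw [box, Pi.card_Icc]
  simp only [Int.card_Icc, Finset.prod_const, Finset.card_univ, Fintype.card_fin]
  congr 1
  omega

lemma box_shift_bound (G : V d → ℝ) (C : ℝ) (hG : ∀ a, |G a| ≤ C) (n m : ℕ) (b : V d)
    (hb : b ∈ box d m) :
    |∑ a ∈ box d n, G (a + b) - ∑ a ∈ box d n, G a| ≤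
      2 * C * ((box d (n + m)).card - (box d n).card) := by
  classical
  have hC : 0 ≤ C := (abs_nonneg _).trans (hG 0)
  have hsub1 : box d n ⊆ box d (n + m) := by
    intro x hx; rw [mem_box] at hx ⊢; intro i; push_cast; have := hx i; omega
  set B := (box d n).map (addRightEmbedding b) with hB
  have hsub2 : B ⊆ box d (n + m) := by
    intro x hx
    rw [hB, Finset.mem_map] at hx
    obtain ⟨a, ha, rfl⟩ := hx
    rw [mem_box] at ha hb ⊢
    intro i
    have h1 := ha i
    have h2 := hb i
    have := abs_add_le (a i) (b i)
    simp only [addRightEmbedding_apply, Pi.add_apply]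
    push_cast; omega
  have h1 : ∑ a ∈ box d n, G (a + b) = ∑ a ∈ B, G a := by rw [hB, Finset.sum_map]; rfl
  have hcard : B.card = (box d n).card := Finset.card_map _
  have gen : ∀ A ⊆ box d (n + m), |∑ a ∈ box d (n + m), G a - ∑ a ∈ A, G a| ≤
      C * ((box d (n + m)).card - A.card) := by
    intro A hA
    rw [← Finset.sum_sdiff hA, add_sub_cancel_right]
    refine (Finset.abs_sum_le_sum_abs _ _).trans ?_
    refine (Finset.sum_le_card_nsmul _ _ C fun a _ => hG a).trans ?_
    rw [Finset.card_sdiff_of_subset hA, nsmul_eq_mul, Nat.cast_sub (Finset.card_le_card hA)]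
    linarith
  have e1 := abs_le.1 (gen _ hsub1)
  have e2 := abs_le.1 (gen _ hsub2)
  rw [hcard] at e2
  rw [h1, abs_le]
  constructor <;> linarith [e1.1, e1.2, e2.1, e2.2]

lemma box_ratio (m : ℕ) : Tendsto (fun n : ℕ =>
    (((box d (n + m)).card : ℝ) - (box d n).card) / (box d n).card) atTop (𝓝 0) := by
  have h1 : ∀ n : ℕ, (((box d (n + m)).card : ℝ) - (box d n).card) / (box d n).card
      = (1 + (2 * m) / (2 * (n:ℝ) + 1)) ^ d - 1 := by
    intro n
    rw [card_box, card_box]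
    push_cast
    have h : (2 * (n:ℝ) + 1) ≠ 0 := by positivity
    rw [sub_div, div_self (pow_ne_zero _ h), ← div_pow]
    congr 2
    field_simp
    ring
  simp only [h1]
  have h2 : Tendsto (fun n : ℕ => (2 * (m:ℝ)) / (2 * (n:ℝ) + 1)) atTop (𝓝 0) := by
    refine Tendsto.div_atTop tendsto_const_nhds ?_
    refine tendsto_atTop_add_const_right _ _ ?_
    exact Tendsto.const_mul_atTop (by norm_num) tendsto_natCast_atTop_atTop
  have h3 := ((tendsto_const_nhds (x := (1:ℝ))).add h2).pow d
  have h4 := h3.sub_const 1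
  simpa using h4

lemma isClopen_cyl (Λ : Finset (V d)) (f : ↥Λ → Bool) : IsClopen (cyl Λ f) := by
  have h : cyl Λ f = (fun (ξ : Config d) (x : ↥Λ) => ξ x) ⁻¹' {f} := by
    ext ξ; rw [mem_cyl_iff]; rfl
  rw [h]
  exact (isClopen_discrete _).preimage (continuous_pi fun x => continuous_apply _)

lemma continuous_ind {S : Set (Config d)} (hS : IsClopen S) :
    Continuous (S.indicator (1 : Config d → ℝ)) :=
  continuous_one.indicator (by simp [hS.frontier_eq])

lemma continuous_translate (a : V d) : Continuous (translate a : Config d → Config d) :=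
  continuous_pi fun _ => continuous_apply _

lemma box_card_pos (n : ℕ) : (0 : ℝ) < (box d n).card := by
  rw [card_box]; positivity

lemma exists_nu (Φ : Interaction d) (n : ℕ) : ∃ μ : ProbabilityMeasure (Config d),
    ∀ g : Config d → ℝ, ∫ x, g x ∂(μ : Measure (Config d)) =
      (∑ a ∈ box d n, ∑ f : ↥(box d (2 * n)) → Bool,
        finGibbs Φ (box d (2 * n)) plusC f *
          g (translate a (fill (box d (2 * n)) f plusC))) / (box d n).card := by
  have hc := box_card_pos (d := d) n
  obtain ⟨μ, h1, h2⟩ := exists_prob (X := Config d)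
    (ι := ↥(box d n) × (↥(box d (2 * n)) → Bool))
    (fun p => finGibbs Φ (box d (2 * n)) plusC p.2 / (box d n).card)
    (fun p => div_nonneg (finGibbs_nonneg _ _ _ _) hc.le)
    (by
      rw [Fintype.sum_prod_type]
      simp only [← Finset.sum_div, sum_finGibbs]
      simp only [Finset.sum_const, Finset.card_univ, Fintype.card_coe, nsmul_eq_mul]
      field_simp)
    (fun p => translate (p.1 : V d) (fill (box d (2 * n)) p.2 plusC))
  refine ⟨⟨μ, h1⟩, fun g => ?_⟩
  rw [ProbabilityMeasure.coe_mk, h2, Fintype.sum_prod_type, Finset.sum_div,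
    ← Finset.sum_coe_sort (box d n)]
  refine Finset.sum_congr rfl fun a _ => ?_
  rw [Finset.sum_div]
  refine Finset.sum_congr rfl fun f _ => ?_
  ring

lemma exists_limit {Φ : Interaction d} (hl : IsLocal Φ) (ht : TransInv Φ) (hs : AbsSummable Φ)
    (hP : ∀ (N : ℕ) (x : V d), ∑ f : ↥(box d N) → Bool,
      (if fill (box d N) f plusC x = false then finGibbs Φ (box d N) plusC f else 0) ≤ 1/3) :
    ∃ σ : Measure (Config d), IsProbabilityMeasure σ ∧
      (∀ Λ f, (σ (cyl Λ f)).toReal = ∫ η, finGibbs Φ Λ η f ∂σ) ∧ MeasTransInv σ ∧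
      (σ {ω | ω 0 = false}).toReal ≤ 1/3 := by
  choose ν hν using exists_nu Φ
  let U : Ultrafilter ℕ := Ultrafilter.of atTop
  have hU : (U : Filter ℕ) ≤ atTop := Ultrafilter.of_le atTop
  obtain ⟨σ, -, hσ⟩ := (isCompact_univ (X := ProbabilityMeasure (Config d))).ultrafilter_le_nhds
    (U.map ν) (by simp)
  have hσ' : Tendsto ν U (𝓝 σ) := hσ
  have lim : ∀ g : Config d → ℝ, Continuous g →
      Tendsto (fun n => ∫ x, g x ∂(ν n : Measure (Config d))) U
        (𝓝 (∫ x, g x ∂(σ : Measure (Config d)))) := fun g hg =>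
    (ProbabilityMeasure.tendsto_iff_forall_integral_tendsto.1 hσ')
      (BoundedContinuousFunction.mkOfCompact ⟨g, hg⟩)
  refine ⟨σ, inferInstance, fun Λ h => ?_, fun b => ?_, ?_⟩
  · have e1 : (((σ : Measure (Config d)) (cyl Λ h)).toReal) =
        ∫ x, (cyl Λ h).indicator 1 x ∂(σ : Measure (Config d)) := by
      rw [integral_indicator_one (isClopen_cyl Λ h).1.measurableSet]; rfl
    rw [e1]
    refine tendsto_nhds_unique (lim _ (continuous_ind (isClopen_cyl Λ h))) ?_
    refine (lim _ (continuous_finGibbs hl ht hs Λ h)).congr' ?_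
    obtain ⟨m, hm⟩ : ∃ m : ℕ, Λ ⊆ box d m := by
      refine ⟨Λ.sup fun y => ∑ i, (y i).natAbs, fun y hy => ?_⟩
      rw [mem_box]
      intro i
      have h1 : (∑ i, (y i).natAbs) ≤ Λ.sup fun y => ∑ i, (y i).natAbs :=
        Finset.le_sup (f := fun y : V d => ∑ i, (y i).natAbs) hy
      have h2 : (y i).natAbs ≤ ∑ i, (y i).natAbs :=
        Finset.single_le_sum (f := fun i => (y i).natAbs) (fun _ _ => Nat.zero_le _)
          (Finset.mem_univ i)
      rw [Int.abs_eq_natAbs]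
      omega
    filter_upwards [hU (eventually_ge_atTop m)] with n hn
    rw [hν, hν]
    congr 1
    refine Finset.sum_congr rfl fun a ha => ?_
    refine (dlr_swap hl ht hs Λ (box d (2 * n)) a (fun y hy => ?_) plusC h).symm
    have hy' := hm hy
    rw [mem_box] at ha hy' ⊢
    intro i
    have h1 := ha i
    have h2 := hy' i
    have := abs_add_le (y i) (a i)
    simp only [Pi.add_apply]
    push_cast; omega
  · have hmt : Measurable (translate b : Config d → Config d) := (continuous_translate b).measurable
    have : IsProbabilityMeasure ((σ : Measure (Config d)).map (translate b)) :=
      Measure.isProbabilityMeasure_map hmt.aemeasurable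
    refine ext_of_forall_integral_eq_of_IsFiniteMeasure fun g => ?_
    rw [integral_map hmt.aemeasurable g.continuous.aestronglyMeasurable]
    have htt : ∀ (a : V d) (ω : Config d), translate b (translate a ω) = translate (a + b) ω := by
      intro a ω
      funext x
      simp only [translate]
      congr 1
      abel
    have l1 := lim _ (g.continuous.comp (continuous_translate b))
    have l2 := lim _ g.continuous
    have l3 := l1.sub l2
    rw [← sub_eq_zero]
    refine tendsto_nhds_unique l3 ?_
    obtain ⟨m, hm⟩ : ∃ m : ℕ, b ∈ box d m := by
      refine ⟨∑ i, (b i).natAbs, ?_⟩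
      rw [mem_box]
      intro i
      have h2 : (b i).natAbs ≤ ∑ i, (b i).natAbs :=
        Finset.single_le_sum (f := fun i => (b i).natAbs) (fun _ _ => Nat.zero_le _)
          (Finset.mem_univ i)
      rw [Int.abs_eq_natAbs]
      omega
    have lr : Tendsto (fun n : ℕ => 2 * ‖g‖ *
        ((((box d (n + m)).card : ℝ) - (box d n).card) / (box d n).card)) U (𝓝 0) := by
      simpa using ((box_ratio (d := d) m).const_mul (2 * ‖g‖)).mono_left hU
    refine squeeze_zero_norm (fun n => ?_) lr
    have hc := box_card_pos (d := d) n
    rw [hν, hν, ← sub_div, Real.norm_eq_abs, abs_div, abs_of_pos hc, ← mul_div_assoc]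
    refine div_le_div_of_nonneg_right ?_ hc.le
    refine box_shift_bound (fun a => ∑ f : ↥(box d (2 * n)) → Bool,
        finGibbs Φ (box d (2 * n)) plusC f *
          g (translate a (fill (box d (2 * n)) f plusC))) ‖g‖ (fun a => ?_) n m b hm |>.trans'
        (le_of_eq ?_)
    · refine (Finset.abs_sum_le_sum_abs _ _).trans ?_
      calc _ ≤ ∑ f : ↥(box d (2 * n)) → Bool, finGibbs Φ (box d (2 * n)) plusC f * ‖g‖ := by
            refine Finset.sum_le_sum fun f _ => ?_
            rw [abs_mul, abs_of_nonneg (finGibbs_nonneg _ _ _ _)]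
            exact mul_le_mul_of_nonneg_left (g.norm_coe_le_norm _) (finGibbs_nonneg _ _ _ _)
        _ = ‖g‖ := by rw [← Finset.sum_mul, sum_finGibbs, one_mul]
    · simp only [Function.comp, htt]
  · have hclo : IsClopen {ω : Config d | ω 0 = false} :=
      (isClopen_discrete {false}).preimage (continuous_apply (0 : V d))
    have e1 : (((σ : Measure (Config d)) {ω | ω 0 = false}).toReal) =
        ∫ x, ({ω : Config d | ω 0 = false}).indicator 1 x ∂(σ : Measure (Config d)) := by
      rw [integral_indicator_one hclo.1.measurableSet]; rfl
    rw [e1]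
    refine le_of_tendsto (lim _ (continuous_ind hclo)) (Eventually.of_forall fun n => ?_)
    have hc := box_card_pos (d := d) n
    rw [hν, div_le_iff₀ hc]
    refine (Finset.sum_le_card_nsmul _ _ (1/3) fun a _ => ?_).trans ?_
    · refine le_trans (le_of_eq ?_) (hP (2 * n) a)
      refine Finset.sum_congr rfl fun f _ => ?_
      simp [Set.indicator_apply, translate]
    · rw [nsmul_eq_mul, mul_comm]

/-- The global spin flip. -/
def gflip (ω : Config d) : Config d := fun x => !(ω x)

lemma continuous_gflip : Continuous (gflip : Config d → Config d) :=
  continuous_pi fun x => continuous_of_discreteTopology.comp (continuous_apply x)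

lemma ham_gflip {Φ : Interaction d} (hf : SpinFlipSymm Φ) (Λ : Finset (V d)) (ω : Config d) :
    ham Φ Λ (gflip ω) = ham Φ Λ ω := by
  refine tsum_congr fun Δ => ?_
  rw [show Φ Δ (gflip ω) = Φ Δ ω from hf Δ ω]

lemma fill_gflip (Λ : Finset (V d)) (f : ↥Λ → Bool) (η : Config d) :
    fill Λ f (gflip η) = gflip (fill Λ (fun x => !(f x)) η) := by
  funext x; by_cases h : x ∈ Λ <;> simp [fill, gflip, h]

lemma gibbsZ_gflip {Φ : Interaction d} (hf : SpinFlipSymm Φ) (Λ : Finset (V d)) (η : Config d) :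
    gibbsZ Φ Λ (gflip η) = gibbsZ Φ Λ η := by
  have hinv : Function.Involutive (fun (f : ↥Λ → Bool) x => !(f x)) := fun f => by simp
  simp only [gibbsZ, fill_gflip, ham_gflip hf]
  exact Equiv.sum_comp hinv.toPerm fun f => Real.exp (-(ham Φ Λ (fill Λ f η)))

lemma finGibbs_gflip {Φ : Interaction d} (hf : SpinFlipSymm Φ) (Λ : Finset (V d)) (η : Config d)
    (f : ↥Λ → Bool) : finGibbs Φ Λ (gflip η) f = finGibbs Φ Λ η (fun x => !(f x)) := by
  simp only [finGibbs, fill_gflip, ham_gflip hf, gibbsZ_gflip hf]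

lemma two_states {Φ : Interaction d} (hl : IsLocal Φ) (ht : TransInv Φ) (hs : AbsSummable Φ)
    (hf : SpinFlipSymm Φ) (σ : Measure (Config d)) (hp : IsProbabilityMeasure σ)
    (hG : ∀ Λ f, (σ (cyl Λ f)).toReal = ∫ η, finGibbs Φ Λ η f ∂σ) (hT : MeasTransInv σ)
    (hm : (σ {ω | ω 0 = false}).toReal ≤ 1/3) :
    ∃ σ₁ σ₂ : Measure (Config d), σ₁ ≠ σ₂ ∧
      IsGibbs Φ σ₁ ∧ MeasTransInv σ₁ ∧ IsGibbs Φ σ₂ ∧ MeasTransInv σ₂ := by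
  have hfm : Measurable (gflip : Config d → Config d) := continuous_gflip.measurable
  have hp2 : IsProbabilityMeasure (σ.map gflip) := Measure.isProbabilityMeasure_map hfm.aemeasurable
  refine ⟨σ, σ.map gflip, ?_, ⟨hp, fun Λ => ⟨σ, hp, hG Λ⟩⟩, hT,
    ⟨hp2, fun Λ => ⟨σ.map gflip, hp2, fun f => ?_⟩⟩, fun b => ?_⟩
  · intro he
    have hclo : IsClopen {ω : Config d | ω 0 = false} :=
      (isClopen_discrete {false}).preimage (continuous_apply (0 : V d))
    have h1 : σ {ω : Config d | ω 0 = false} = σ {ω : Config d | ω 0 = false}ᶜ := by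
      conv_lhs => rw [he, Measure.map_apply hfm hclo.1.measurableSet]
      congr 1
      ext ω
      simp [gflip]
    have h2 := prob_compl_eq_one_sub (μ := σ) hclo.1.measurableSet
    rw [← h1] at h2
    have h3 : σ.real {ω : Config d | ω 0 = false} + σ.real {ω : Config d | ω 0 = false}ᶜ = 1 :=
      probReal_add_probReal_compl hclo.1.measurableSet
    have h4 : σ.real {ω : Config d | ω 0 = false} ≤ 1/3 := hm
    have h5 : σ.real {ω : Config d | ω 0 = false}ᶜ = σ.real {ω : Config d | ω 0 = false} := by
      simp only [Measure.real, h1]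
    linarith
  · rw [Measure.map_apply hfm (isClopen_cyl Λ f).1.measurableSet,
      integral_map hfm.aemeasurable
        (continuous_finGibbs hl ht hs Λ f).aestronglyMeasurable]
    simp only [finGibbs_gflip hf]
    rw [← hG]
    congr 2
    ext ω
    simp only [Set.mem_preimage, cyl, Set.mem_ofPred_eq, gflip]
    refine forall_congr' fun x => forall_congr' fun h => ?_
    cases ω x <;> cases f ⟨x, h⟩ <;> simp
  · have hmt : Measurable (translate b : Config d → Config d) := (continuous_translate b).measurable
    rw [Measure.map_map hmt hfm]
    conv_rhs => rw [← hT b, Measure.map_map hfm hmt]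
    rfl

lemma iadd_flip {Φ Ψ : Interaction d} (h1 : SpinFlipSymm Φ) (h2 : SpinFlipSymm Ψ) :
    SpinFlipSymm (Iadd Φ Ψ) :=
  fun Λ ω => by simp only [Iadd]; rw [h1 Λ ω, h2 Λ ω]

/-- There exists `0 < L < ∞` such that whenever `β, δ > 0` satisfy
`β - δ > L`, for every translation invariant, spin-flip symmetric interaction `Ψ` with
`‖Ψ‖ < δ` which is zero on non-`‖·‖₁`-connected sets, the interaction `Φ = Φ^β + Ψ` has
at least two distinct translation-invariant Gibbs states. -/
theorem coexistence_connected (d : ℕ) (hd : 2 ≤ d) :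
    ∃ L > (0:ℝ), ∀ β δ : ℝ, 0 < β → 0 < δ → L < β - δ →
      ∀ Ψ : Interaction d, IsLocal Ψ → TransInv Ψ → SpinFlipSymm Ψ → ZeroOnNonConn Ψ →
        AbsSummable Ψ → anorm Ψ < δ →
        ∃ σ₁ σ₂ : Measure (Config d), σ₁ ≠ σ₂ ∧
          IsGibbs (Iadd (ising β) Ψ) σ₁ ∧ MeasTransInv σ₁ ∧
          IsGibbs (Iadd (ising β) Ψ) σ₂ ∧ MeasTransInv σ₂ := by
  have hD : (1:ℝ) ≤ (DD d : ℝ) := by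
    have : 1 ≤ DD d := Nat.one_le_iff_ne_zero.2 (by simp only [DD]; positivity)
    exact_mod_cast this
  refine ⟨16 * (DD d : ℝ) ^ 2, by positivity, ?_⟩
  intro β δ _ _ hL Ψ hl ht hf hz hs hn
  have hLD : Real.exp (-(2 * (16 * (DD d : ℝ) ^ 2))) * (DD d:ℝ)^2 ≤ 1/16 := by
    rw [Real.exp_neg, inv_mul_le_iff₀ (Real.exp_pos _)]
    have := Real.add_one_le_exp (2 * (16 * (DD d : ℝ) ^ 2))
    nlinarith
  have hP := peierls hd β (16 * (DD d : ℝ) ^ 2) hl ht hf hz hs (by linarith) hLD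
  have l' := iadd_local (ising_local β) hl
  have t' := iadd_transInv (ising_transInv β) ht
  have s' := iadd_summable (ising_local β) hl (ising_summable β) hs
  obtain ⟨σ, h1, h2, h3, h4⟩ := exists_limit l' t' s' hP
  exact two_states l' t' s' (iadd_flip (ising_flip β) hf) σ h1 h2 h3 h4

end
end Ising
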